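/- Let α ∈ (0,1), let r ≥ 2 be an integer, and let 0 < β < min{α, (2/3)(1−α)}. Then for every sufficiently large integer γ, P(for every integer a ≥ 1 with V_{γ,r}(a) ≤ n^β, the graph G(n, n^{−α}) contains an induced copy of W_a^{γ,*}) → 1 as n → ∞. -/

import Mathlib

open Filter FirstOrder

noncomputable section

/-! ### The binomial random graph `G(n,p)` -/

/-- The number of edges of a simple graph. -/
noncomputable def edgeCt {n : ℕ} (G : SimpleGraph (Fin n)) : ℕ := Nat.card G.edgeSet

open scoped Classical in
/-- `prob n p Q` is the probability that the binomial random graph `G(n,p)` (on vertex set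
`Fin n`) has property `Q`: the sum over all graphs `G` with `Q G` of
`p^{e(G)} (1-p)^{n(n-1)/2 - e(G)}`. -/
noncomputable def prob (n : ℕ) (p : ℝ) (Q : SimpleGraph (Fin n) → Prop) : ℝ :=
  ∑ G : SimpleGraph (Fin n),
    if Q G then p ^ edgeCt G * (1 - p) ^ (n * (n - 1) / 2 - edgeCt G) else 0

/-- `expec n p W` is the expectation of a real-valued function `W` of the binomial random
graph `G(n,p)`. -/
noncomputable def expec (n : ℕ) (p : ℝ) (W : SimpleGraph (Fin n) → ℝ) : ℝ :=
  ∑ G : SimpleGraph (Fin n),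
    W G * (p ^ edgeCt G * (1 - p) ^ (n * (n - 1) / 2 - edgeCt G))

/-! ### The graphs `W_a^γ` and `W_a^{γ,*}` -/

/-- `ωr r a = (r^a − 1)/(r−1)`, the number of vertices of the perfect `r`-ary tree of
depth `a − 1`. -/
def ωr (r a : ℕ) : ℕ := (r ^ a - 1) / (r - 1)

/-- The depth of the node with (0-based) breadth-first (heap) index `j` in the infinite
`r`-ary tree: the root has index 0, and the parent of node `j ≥ 1` is node `(j−1)/r`. -/
def heapDepth (r : ℕ) : ℕ → ℕ
  | 0 => 0
  | j + 1 => heapDepth r (j / r) + 1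
  decreasing_by exact Nat.lt_succ_of_le (Nat.div_le_self _ _)

/-- The vertex set of `W_a^γ`: the path `F₁` on `a` vertices (`Sum.inl`), together with,
for each of the `(4^a−1)/3` vertices `i` of the perfect 4-ary tree `F₂` (in breadth-first
order), the vertex `(i,0)` of `F₂` itself and the `γ` inner vertices `(i,1),…,(i,γ)` of the
path `P_{γ+2}` joining `i` to the vertex of `F₁` at the same distance from the root. -/
abbrev WVert (γ a : ℕ) := Fin a ⊕ (Fin (ωr 4 a) × Fin (γ + 1))

/-- Base (directed) adjacency relation generating `W_a^γ`: consecutive `F₁`-vertices;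
the last inner path vertex `(i,γ)` is joined to the `F₁`-vertex at depth of `i`;
consecutive vertices along each `P_{γ+2}`; and tree edges of the perfect 4-ary tree
(in heap indexing, `j` is the parent of `i ≥ 1` iff `j = (i−1)/4`). -/
def Wbase (γ a : ℕ) : WVert γ a → WVert γ a → Prop
  | Sum.inl u, Sum.inl v => (v : ℕ) = (u : ℕ) + 1
  | Sum.inl u, Sum.inr iv => (iv.2 : ℕ) = γ ∧ heapDepth 4 (iv.1 : ℕ) = (u : ℕ)
  | Sum.inr _, Sum.inl _ => False
  | Sum.inr iv, Sum.inr jw =>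
      (iv.1 = jw.1 ∧ (jw.2 : ℕ) = (iv.2 : ℕ) + 1) ∨
      ((iv.2 : ℕ) = 0 ∧ (jw.2 : ℕ) = 0 ∧ 1 ≤ (iv.1 : ℕ) ∧ (jw.1 : ℕ) = ((iv.1 : ℕ) - 1) / 4)

/-- The graph `W_a^γ`. -/
def WG (γ a : ℕ) : SimpleGraph (WVert γ a) := SimpleGraph.fromRel (Wbase γ a)

/-- The vertex set of `W_a^{γ,*}` (with `ω₁ = ωr r a`, `ω₂ = ωr r ω₁`), as five pieces:
the path `F₁` on `a` vertices; the tree `F₂` together with the inner vertices of the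
paths `P_{γ+2}` joining `F₂` to `F₁` (pairs `(i,k)`, `k = 0` being the `F₂`-vertex itself);
the `γ` inner vertices of the paths `P_{γ+2}` joining the `i`-th vertex of `F₂` (in
breadth-first order) to the `i`-th vertex of the path `F̃₁`; the path `F̃₁` on `ω₁`
vertices; and the tree `F̃₂` together with the inner vertices of the paths `P_{γ+2}`
joining `F̃₂` to `F̃₁`. -/
abbrev WSVert (γ r a : ℕ) :=
  Fin a ⊕ ((Fin (ωr r a) × Fin (γ + 1)) ⊕ ((Fin (ωr r a) × Fin γ) ⊕
    (Fin (ωr r a) ⊕ (Fin (ωr r (ωr r a)) × Fin (γ + 1)))))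

/-- Base (directed) adjacency relation generating `W_a^{γ,*}`. -/
def WSbase (γ r a : ℕ) : WSVert γ r a → WSVert γ r a → Prop
  | .inl u, .inl v => (v : ℕ) = (u : ℕ) + 1
  | .inl u, .inr (.inl iv) => (iv.2 : ℕ) = γ ∧ heapDepth r (iv.1 : ℕ) = (u : ℕ)
  | .inr (.inl iv), .inr (.inl jw) =>
      (iv.1 = jw.1 ∧ (jw.2 : ℕ) = (iv.2 : ℕ) + 1) ∨
      ((iv.2 : ℕ) = 0 ∧ (jw.2 : ℕ) = 0 ∧ 1 ≤ (iv.1 : ℕ) ∧ (jw.1 : ℕ) = ((iv.1 : ℕ) - 1) / r)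
  | .inr (.inl iv), .inr (.inr (.inl jm)) => (iv.2 : ℕ) = 0 ∧ iv.1 = jm.1 ∧ (jm.2 : ℕ) = 0
  | .inr (.inl iv), .inr (.inr (.inr (.inl d))) => γ = 0 ∧ (iv.2 : ℕ) = 0 ∧ (iv.1 : ℕ) = (d : ℕ)
  | .inr (.inr (.inl im)), .inr (.inr (.inl jm)) => im.1 = jm.1 ∧ (jm.2 : ℕ) = (im.2 : ℕ) + 1
  | .inr (.inr (.inl im)), .inr (.inr (.inr (.inl d))) =>
      (im.2 : ℕ) + 1 = γ ∧ (im.1 : ℕ) = (d : ℕ)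
  | .inr (.inr (.inr (.inl d))), .inr (.inr (.inr (.inl e))) => (e : ℕ) = (d : ℕ) + 1
  | .inr (.inr (.inr (.inl d))), .inr (.inr (.inr (.inr jw))) =>
      (jw.2 : ℕ) = γ ∧ heapDepth r (jw.1 : ℕ) = (d : ℕ)
  | .inr (.inr (.inr (.inr iv))), .inr (.inr (.inr (.inr jw))) =>
      (iv.1 = jw.1 ∧ (jw.2 : ℕ) = (iv.2 : ℕ) + 1) ∨
      ((iv.2 : ℕ) = 0 ∧ (jw.2 : ℕ) = 0 ∧ 1 ≤ (iv.1 : ℕ) ∧ (jw.1 : ℕ) = ((iv.1 : ℕ) - 1) / r)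
  | _, _ => False

/-- The graph `W_a^{γ,*}`. -/
def WSG (γ r a : ℕ) : SimpleGraph (WSVert γ r a) := SimpleGraph.fromRel (WSbase γ r a)

/-- `Vnum γ r a = V_{γ,r}(a) = a + 2(γ+1)ω_r(a) + (γ+1)ω_r(ω_r(a))`,
the number of vertices of `W_a^{γ,*}`. -/
def Vnum (γ r a : ℕ) : ℕ := a + 2 * (γ + 1) * ωr r a + (γ + 1) * ωr r (ωr r a)

/-- `s` is (the vertex set of) an induced copy of `H` in `G`. -/
def IsInducedCopy {V W : Type} (H : SimpleGraph W) (G : SimpleGraph V) (s : Set V) : Prop :=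
  Nonempty (H ≃g G.induce s)

/-! ### The quantities `k_γ` and `f` -/

/-- `kcoef α γ = k_γ = 2(1 − α(γ+2)/(γ+1))`. -/
def kcoef (α : ℝ) (γ : ℕ) : ℝ := 2 * (1 - α * ((γ : ℝ) + 2) / ((γ : ℝ) + 1))

/-- `ff α x = f(x) = x^α · ln x`. -/
def ff (α x : ℝ) : ℝ := x ^ α * Real.log x

/-! ### The language `L_m` and EMSO satisfaction -/

/-- Relation symbols of the language `L_m`: `m` unary symbols and one binary symbol. -/
def LRel (m : ℕ) : ℕ → Type
  | 1 => Fin m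
  | 2 => Unit
  | _ => Empty

/-- The first-order language `L_m`: one binary relation symbol, `m` unary relation symbols
and no function symbols. -/
def Lang (m : ℕ) : Language where
  Functions := fun _ => Empty
  Relations := LRel m

/-- The `L_m`-structure on `Fin n` whose binary relation is adjacency in the graph `G` and
whose `i`-th unary relation is membership in `S i`. -/
def structOf {n m : ℕ} (G : SimpleGraph (Fin n)) (S : Fin m → Set (Fin n)) :
    (Lang m).Structure (Fin n) where
  funMap := fun f _ => Empty.elim f
  RelMap := fun {k} r v =>
    match k, r, v with
    | 1, i, v => v 0 ∈ S i
    | 2, _, v => G.Adj (v 0) (v 1)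
    | 0, r, _ => Empty.elim r
    | (_ + 3), r, _ => Empty.elim r

/-- `G` EMSO-satisfies the `L_m`-sentence `φ`: there are sets `S 0, …, S (m-1)` of vertices
such that the structure on `Fin n` given by adjacency in `G` and membership in the `S i`
satisfies `φ`. -/
def EMSOSat {n m : ℕ} (G : SimpleGraph (Fin n)) (φ : (Lang m).Sentence) : Prop :=
  ∃ S : Fin m → Set (Fin n),
    @FirstOrder.Language.Sentence.Realize (Lang m) (Fin n) (structOf G S) φ


/-! ### Sums over random subsets -/

/-- The expectation of `f` at the random subset of `E` that contains each element
independently with probability `p`. -/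
def subsetExp {ι : Type*} [DecidableEq ι] (p : ℝ) (E : Finset ι) (f : Finset ι → ℝ) : ℝ :=
  ∑ s ∈ E.powerset, p ^ s.card * (1 - p) ^ (E.card - s.card) * f s

section SubsetExp

variable {ι : Type*} [DecidableEq ι] {p : ℝ}

theorem subsetExp_empty (f : Finset ι → ℝ) : subsetExp p ∅ f = f ∅ := by
  simp [subsetExp]

theorem subsetExp_insert {e : ι} {E : Finset ι} (he : e ∉ E) (f : Finset ι → ℝ) :
    subsetExp p (insert e E) f =
      (1 - p) * subsetExp p E f + p * subsetExp p E (fun s => f (insert e s)) := by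
  unfold subsetExp
  rw [Finset.sum_powerset_insert he, Finset.mul_sum, Finset.mul_sum]
  congr 1
  · refine Finset.sum_congr rfl fun s hs => ?_
    have hc := Finset.card_le_card (Finset.mem_powerset.1 hs)
    rw [Finset.card_insert_of_notMem he, Nat.sub_add_comm hc, pow_succ]
    ring
  · refine Finset.sum_congr rfl fun s hs => ?_
    have hes : e ∉ s := fun h => he (Finset.mem_powerset.1 hs h)
    rw [Finset.card_insert_of_notMem he, Finset.card_insert_of_notMem hes,
      Nat.add_sub_add_right, pow_succ]
    ring

theorem subsetExp_congr {E : Finset ι} {f g : Finset ι → ℝ} (h : ∀ s ⊆ E, f s = g s) :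
    subsetExp p E f = subsetExp p E g :=
  Finset.sum_congr rfl fun s hs => by rw [h s (Finset.mem_powerset.1 hs)]

theorem subsetExp_mono (hp0 : 0 ≤ p) (hp1 : p ≤ 1) {E : Finset ι} {f g : Finset ι → ℝ}
    (h : ∀ s ⊆ E, f s ≤ g s) : subsetExp p E f ≤ subsetExp p E g := by
  refine Finset.sum_le_sum fun s hs => ?_
  have h1 : 0 ≤ 1 - p := by linarith
  exact mul_le_mul_of_nonneg_left (h s (Finset.mem_powerset.1 hs)) (by positivity)

theorem subsetExp_const_mul (E : Finset ι) (c : ℝ) (f : Finset ι → ℝ) :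
    subsetExp p E (fun s => c * f s) = c * subsetExp p E f := by
  unfold subsetExp
  rw [Finset.mul_sum]
  exact Finset.sum_congr rfl fun s _ => by ring

theorem subsetExp_add (E : Finset ι) (f g : Finset ι → ℝ) :
    subsetExp p E (fun s => f s + g s) = subsetExp p E f + subsetExp p E g := by
  unfold subsetExp
  rw [← Finset.sum_add_distrib]
  exact Finset.sum_congr rfl fun s _ => by ring

theorem subsetExp_sum {κ : Type*} (E : Finset ι) (K : Finset κ) (f : κ → Finset ι → ℝ) :
    subsetExp p E (fun s => ∑ k ∈ K, f k s) = ∑ k ∈ K, subsetExp p E (f k) := by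
  unfold subsetExp
  rw [Finset.sum_comm]
  exact Finset.sum_congr rfl fun s _ => by rw [Finset.mul_sum]

theorem subsetExp_const (E : Finset ι) (c : ℝ) : subsetExp p E (fun _ => c) = c := by
  induction E using Finset.induction_on with
  | empty => exact subsetExp_empty _
  | insert e E he ih => rw [subsetExp_insert he, ih]; ring

theorem subsetExp_union {E F : Finset ι} (h : Disjoint E F) (f : Finset ι → ℝ) :
    subsetExp p (E ∪ F) f = subsetExp p E (fun s => subsetExp p F (fun t => f (s ∪ t))) := by
  induction E using Finset.induction_on generalizing f with
  | empty => simp [subsetExp_empty]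
  | insert e E he ih =>
    rw [Finset.disjoint_insert_left] at h
    rw [Finset.insert_union, subsetExp_insert (by simp [he, h.1]), subsetExp_insert he,
      ih h.2, ih h.2]
    simp only [Finset.insert_union]

/-- Functions of disjoint blocks of a random subset are independent. -/
theorem subsetExp_prod {κ : Type*} [DecidableEq κ] (R : Finset κ) (B : κ → Finset ι)
    (f : κ → Finset ι → ℝ) {E : Finset ι} (hB : ∀ w ∈ R, B w ⊆ E)
    (hd : ∀ w ∈ R, ∀ w' ∈ R, w ≠ w' → Disjoint (B w) (B w')) :
    subsetExp p E (fun s => ∏ w ∈ R, f w (s ∩ B w)) = ∏ w ∈ R, subsetExp p (B w) (f w) := by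
  induction R using Finset.induction_on generalizing E with
  | empty => simp [subsetExp_const]
  | insert w R hw ih =>
    have hE : E = B w ∪ (E \ B w) :=
      (Finset.union_sdiff_of_subset (hB w (Finset.mem_insert_self _ _))).symm
    have hdw : ∀ v ∈ R, Disjoint (B v) (B w) := fun v hv =>
      hd v (Finset.mem_insert_of_mem hv) w (Finset.mem_insert_self _ _)
        (fun h => hw (h ▸ hv))
    have key : ∀ s ⊆ B w, ∀ t ⊆ E \ B w,
        (∏ v ∈ insert w R, f v ((s ∪ t) ∩ B v)) = f w s * ∏ v ∈ R, f v (t ∩ B v) := by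
      intro s hs t ht
      rw [Finset.prod_insert hw]
      congr 1
      · congr 1
        ext x
        have h1 := @hs x
        have h2 := @ht x
        simp only [Finset.mem_inter, Finset.mem_union, Finset.mem_sdiff] at *
        tauto
      · refine Finset.prod_congr rfl fun v hv => ?_
        congr 1
        ext x
        have h1 := @hs x
        have h3 : x ∈ B v → x ∉ B w := fun hx => Finset.disjoint_left.1 (hdw v hv) hx
        simp only [Finset.mem_inter, Finset.mem_union] at *
        tauto
    rw [Finset.prod_insert hw, hE, subsetExp_union Finset.disjoint_sdiff]
    rw [subsetExp_congr (g := fun s => (∏ v ∈ R, subsetExp p (B v) (f v)) * f w s),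
      subsetExp_const_mul, mul_comm]
    intro s hs
    rw [subsetExp_congr (key s hs), subsetExp_const_mul, ih, mul_comm]
    · intro v hv x hx
      have h3 := Finset.disjoint_left.1 (hdw v hv) hx
      exact Finset.mem_sdiff.2 ⟨hB v (Finset.mem_insert_of_mem hv) hx, h3⟩
    · exact fun v hv v' hv' => hd v (Finset.mem_insert_of_mem hv) v' (Finset.mem_insert_of_mem hv')

theorem subsetExp_disjoint {B F : Finset ι} (hF : F ⊆ B) :
    subsetExp p B (fun s => if Disjoint s F then 1 else 0) = (1 - p) ^ F.card := by
  have hB : B = F ∪ (B \ F) := (Finset.union_sdiff_of_subset hF).symm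
  have key : ∀ s ⊆ F, ∀ t ⊆ B \ F,
      (if Disjoint (s ∪ t) F then (1 : ℝ) else 0) = if s = ∅ then 1 else 0 := by
    intro s hs t ht
    have ht' : Disjoint t F := Finset.disjoint_of_subset_left ht Finset.sdiff_disjoint
    congr 1
    rw [Finset.disjoint_union_left, eq_iff_iff]
    constructor
    · rintro ⟨h, -⟩
      exact Finset.disjoint_self_iff_empty _ |>.1 (Finset.disjoint_of_subset_right hs h)
    · rintro rfl
      exact ⟨Finset.disjoint_empty_left _, ht'⟩
  conv_lhs => rw [hB, subsetExp_union Finset.disjoint_sdiff]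
  rw [subsetExp_congr (g := fun s => if s = ∅ then 1 else 0)]
  · simp [subsetExp]
  · intro s hs
    rw [subsetExp_congr (key s hs), subsetExp_const]

end SubsetExp

/-! ### The random graph as a random set of edges -/

open scoped Classical in
theorem prob_eq_subsetExp (n : ℕ) (p : ℝ) (Q : SimpleGraph (Fin n) → Prop) :
    prob n p Q = subsetExp p (⊤ : SimpleGraph (Fin n)).edgeFinset
      (fun s => if Q (SimpleGraph.fromEdgeSet (s : Set (Sym2 (Fin n)))) then 1 else 0) := by
  unfold prob subsetExp
  refine Finset.sum_bij' (fun G _ => G.edgeFinset)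
    (fun s _ => SimpleGraph.fromEdgeSet (s : Set (Sym2 (Fin n)))) ?_ ?_ ?_ ?_ ?_
  · intro G _
    exact Finset.mem_powerset.2 (SimpleGraph.edgeFinset_mono le_top)
  · simp
  · intro G _
    simp
  · intro s hs
    ext e
    have h : e ∈ s → e ∈ _ := fun he => Finset.mem_powerset.1 hs he
    simp at h ⊢
    exact h
  · intro G _
    have h1 : edgeCt G = G.edgeFinset.card := by
      rw [edgeCt, Nat.card_eq_fintype_card, SimpleGraph.edgeFinset_card]
    have h2 : (⊤ : SimpleGraph (Fin n)).edgeFinset.card = n * (n - 1) / 2 := by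
      rw [SimpleGraph.card_edgeFinset_top_eq_card_choose_two, Fintype.card_fin, Nat.choose_two_right]
    rw [h2, h1]
    simp

theorem prob_mono {n : ℕ} {p : ℝ} (hp0 : 0 ≤ p) (hp1 : p ≤ 1)
    {Q Q' : SimpleGraph (Fin n) → Prop} (h : ∀ G, Q G → Q' G) : prob n p Q ≤ prob n p Q' := by
  rw [prob_eq_subsetExp, prob_eq_subsetExp]
  refine subsetExp_mono hp0 hp1 fun s _ => ?_
  have := h (SimpleGraph.fromEdgeSet (s : Set (Sym2 (Fin n))))
  split_ifs <;> first | (norm_num; done) | tauto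

theorem prob_not {n : ℕ} {p : ℝ} (Q : SimpleGraph (Fin n) → Prop) :
    prob n p Q = 1 - prob n p (fun G => ¬ Q G) := by
  rw [prob_eq_subsetExp, prob_eq_subsetExp, eq_sub_iff_add_eq, ← subsetExp_add]
  rw [subsetExp_congr (g := fun _ => 1), subsetExp_const]
  intro s _
  split_ifs <;> simp

theorem prob_le_one {n : ℕ} {p : ℝ} (hp0 : 0 ≤ p) (hp1 : p ≤ 1)
    (Q : SimpleGraph (Fin n) → Prop) : prob n p Q ≤ 1 := by
  rw [prob_eq_subsetExp]
  refine (subsetExp_mono hp0 hp1 (g := fun _ => 1) fun s _ => ?_).trans_eq (subsetExp_const _ _)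
  split_ifs <;> norm_num

theorem prob_or_le {n : ℕ} {p : ℝ} (hp0 : 0 ≤ p) (hp1 : p ≤ 1)
    (Q Q' : SimpleGraph (Fin n) → Prop) :
    prob n p (fun G => Q G ∨ Q' G) ≤ prob n p Q + prob n p Q' := by
  rw [prob_eq_subsetExp, prob_eq_subsetExp, prob_eq_subsetExp, ← subsetExp_add]
  refine subsetExp_mono hp0 hp1 fun s _ => ?_
  split_ifs <;> first | (norm_num; done) | tauto

/-- The union bound. -/
theorem prob_exists_le {n : ℕ} {p : ℝ} (hp0 : 0 ≤ p) (hp1 : p ≤ 1) {κ : Type*} (K : Finset κ)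
    (Q : κ → SimpleGraph (Fin n) → Prop) :
    prob n p (fun G => ∃ k ∈ K, Q k G) ≤ ∑ k ∈ K, prob n p (Q k) := by
  simp only [prob_eq_subsetExp]
  rw [← subsetExp_sum]
  refine subsetExp_mono hp0 hp1 fun s _ => ?_
  split_ifs with h
  · obtain ⟨k, hk, hQ⟩ := h
    refine le_trans ?_ (Finset.single_le_sum (fun i _ => ?_) hk)
    · rw [if_pos hQ]
    · split_ifs <;> norm_num
  · exact Finset.sum_nonneg fun i _ => by split_ifs <;> norm_num

theorem card_filter_card_le (n j : ℕ) :
    ((Finset.univ : Finset (Finset (Fin n))).filter (fun s => s.card ≤ j)).card ≤ (n + 1) ^ j := by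
  induction j with
  | zero => simp [Finset.filter_eq']
  | succ j ih =>
    have hsub : (Finset.univ : Finset (Finset (Fin n))).filter (fun s => s.card ≤ j + 1) ⊆
        ((Finset.univ : Finset (Option (Fin n))) ×ˢ
          (Finset.univ : Finset (Finset (Fin n))).filter (fun s => s.card ≤ j)).image
          (fun q => q.1.elim q.2 (fun x => insert x q.2)) := by
      intro s hs
      simp only [Finset.mem_filter, Finset.mem_univ, true_and, Finset.mem_image,
        Finset.mem_product] at hs ⊢
      rcases s.eq_empty_or_nonempty with rfl | ⟨x, hx⟩
      · exact ⟨(none, ∅), by simp⟩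
      · refine ⟨(some x, s.erase x), ?_, by simp [Finset.insert_erase hx]⟩
        rw [Finset.card_erase_of_mem hx]
        omega
    calc _ ≤ _ := Finset.card_le_card hsub
      _ ≤ _ := Finset.card_image_le
      _ ≤ (n + 1) * (n + 1) ^ j := by
        rw [Finset.card_product]
        simpa using Nat.mul_le_mul_left (n + 1) ih
      _ = _ := by ring

/-! ### Expansion and joining properties of the random graph -/

/-- Every nonempty set `A` of at most `ℓ` vertices has a neighbour avoiding any given set `T`
and having no neighbour in any given set `U` disjoint from `A`, as long as `T` and `U` are at
most `M` times larger than `A` and `U` has at most `ℓ` elements. -/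
def IsExpanding {V : Type*} (G : SimpleGraph V) (M ℓ : ℕ) : Prop :=
  ∀ A U T : Finset V, A.Nonempty → Disjoint A U → A.card ≤ ℓ → U.card ≤ ℓ →
    U.card ≤ M * A.card → T.card ≤ M * A.card →
    ∃ w, w ∉ A ∧ w ∉ U ∧ w ∉ T ∧ (∃ a ∈ A, G.Adj w a) ∧ ∀ u ∈ U, ¬ G.Adj w u

/-- There is an edge between any two disjoint sets of `s` vertices. -/
def IsJoining {V : Type*} (G : SimpleGraph V) (s : ℕ) : Prop :=
  ∀ A B : Finset V, Disjoint A B → A.card = s → B.card = s → ∃ a ∈ A, ∃ b ∈ B, G.Adj a b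

section RandomGraph

variable {n : ℕ} {p : ℝ}

theorem card_image_mk (F : Finset (Fin n)) (w : Fin n) :
    (F.image (fun a => s(w, a))).card = F.card := by
  exact Finset.card_image_of_injective _ fun a b h => Sym2.congr_right.1 h

theorem prob_forall_not_expand_le (hp0 : 0 ≤ p) (hp1 : p ≤ 1) (A U T : Finset (Fin n))
    (hAU : Disjoint A U) :
    prob n p (fun G => ∀ w, w ∉ A → w ∉ U → w ∉ T →
        ¬ ((∃ a ∈ A, G.Adj w a) ∧ ∀ u ∈ U, ¬ G.Adj w u)) ≤
      (1 - (1 - p) ^ U.card + (1 - p) ^ (A.card + U.card)) ^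
        (Finset.univ \ (A ∪ U ∪ T)).card := by
  set R : Finset (Fin n) := Finset.univ \ (A ∪ U ∪ T) with hR
  have hRmem : ∀ w, w ∈ R ↔ w ∉ A ∧ w ∉ U ∧ w ∉ T := by
    intro w; simp [hR]
  let FU : Fin n → Finset (Sym2 (Fin n)) := fun w => U.image (fun a => s(w, a))
  let B : Fin n → Finset (Sym2 (Fin n)) := fun w => (A ∪ U).image (fun a => s(w, a))
  let f : Fin n → Finset (Sym2 (Fin n)) → ℝ := fun w s =>
    (1 + (-1) * (if Disjoint s (FU w) then 1 else 0)) + (if Disjoint s (B w) then 1 else 0)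
  have hFB : ∀ w, FU w ⊆ B w := fun w => Finset.image_subset_image Finset.subset_union_right
  have hexp : ∀ w, subsetExp p (B w) (f w) = 1 - (1 - p) ^ U.card + (1 - p) ^ (A.card + U.card) := by
    intro w
    simp only [f]
    rw [subsetExp_add, subsetExp_add, subsetExp_const, subsetExp_const_mul,
      subsetExp_disjoint (hFB w), subsetExp_disjoint (Finset.Subset.refl _), card_image_mk,
      card_image_mk, Finset.card_union_of_disjoint hAU]
    ring
  have hprod := subsetExp_prod (p := p) R B f (E := (⊤ : SimpleGraph (Fin n)).edgeFinset) ?_ ?_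
  · rw [Finset.prod_congr rfl (fun w _ => hexp w), Finset.prod_const] at hprod
    rw [← hprod, prob_eq_subsetExp]
    refine subsetExp_mono hp0 hp1 fun s _ => ?_
    have hf : ∀ w, f w (s ∩ B w) =
        if Disjoint s (FU w) ∧ ¬ Disjoint s (B w) then 0 else 1 := by
      intro w
      have h1 : Disjoint (s ∩ B w) (FU w) ↔ Disjoint s (FU w) := by
        rw [Finset.disjoint_left, Finset.disjoint_left]
        refine ⟨fun h x hx hx' => h (Finset.mem_inter.2 ⟨hx, hFB w hx'⟩) hx', fun h x hx => ?_⟩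
        exact h (Finset.mem_inter.1 hx).1
      have h2 : Disjoint (s ∩ B w) (B w) ↔ Disjoint s (B w) := by
        rw [Finset.disjoint_left, Finset.disjoint_left]
        refine ⟨fun h x hx hx' => h (Finset.mem_inter.2 ⟨hx, hx'⟩) hx', fun h x hx => ?_⟩
        exact h (Finset.mem_inter.1 hx).1
      have h3 : Disjoint s (B w) → Disjoint s (FU w) := Finset.disjoint_of_subset_right (hFB w)
      simp only [f, h1, h2]
      by_cases h4 : Disjoint s (FU w) <;> by_cases h5 : Disjoint s (B w) <;> simp_all
    have hnonneg : 0 ≤ ∏ w ∈ R, f w (s ∩ B w) :=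
      Finset.prod_nonneg fun w _ => by rw [hf]; split_ifs <;> norm_num
    split_ifs with h
    · rw [Finset.prod_eq_one]
      intro w hw
      rw [hf, if_neg]
      rintro ⟨h1, h2⟩
      obtain ⟨hwA, hwU, hwT⟩ := (hRmem w).1 hw
      refine h w hwA hwU hwT ⟨?_, ?_⟩
      · rw [Finset.not_disjoint_iff] at h2
        obtain ⟨e, hes, heB⟩ := h2
        obtain ⟨a, ha, rfl⟩ := Finset.mem_image.1 heB
        rcases Finset.mem_union.1 ha with ha | ha
        · refine ⟨a, ha, ?_⟩
          rw [SimpleGraph.fromEdgeSet_adj]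
          exact ⟨hes, fun h => hwA (h ▸ ha)⟩
        · exact absurd (Finset.mem_image_of_mem _ ha) (Finset.disjoint_left.1 h1 hes)
      · intro u hu hadj
        rw [SimpleGraph.fromEdgeSet_adj] at hadj
        exact Finset.disjoint_left.1 h1 hadj.1 (Finset.mem_image_of_mem _ hu)
    · exact hnonneg
  · intro w hw e he
    obtain ⟨a, ha, rfl⟩ := Finset.mem_image.1 he
    obtain ⟨hwA, hwU, hwT⟩ := (hRmem w).1 hw
    have hne : w ≠ a := by
      rintro rfl
      rcases Finset.mem_union.1 ha with ha | ha <;> contradiction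
    simpa using hne
  · intro w hw w' hw' hne
    rw [Finset.disjoint_left]
    intro e he he'
    obtain ⟨a, ha, rfl⟩ := Finset.mem_image.1 he
    obtain ⟨a', ha', h⟩ := Finset.mem_image.1 he'
    obtain ⟨hwA, hwU, -⟩ := (hRmem w).1 hw
    rw [Sym2.eq_iff] at h
    rcases h with ⟨h1, -⟩ | ⟨-, h2⟩
    · exact hne h1.symm
    · subst h2
      rcases Finset.mem_union.1 ha' with h | h <;> contradiction

theorem one_sub_pow_add_pow_le (hp0 : 0 ≤ p) (hp1 : p ≤ 1) {k u : ℕ} (hk : k * p ≤ 1)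
    (hu : u * p ≤ 1 / 2) :
    1 - (1 - p) ^ u + (1 - p) ^ (k + u) ≤ Real.exp (-(k * p / 4)) := by
  have h1 : 1 / 2 ≤ (1 - p) ^ u := by
    have := one_add_mul_le_pow (a := -p) (by linarith) u
    rw [← sub_eq_add_neg] at this
    linarith
  have hkp : 0 ≤ k * p := by positivity
  have h2 : (1 - p) ^ k ≤ 1 - k * p / 2 := by
    have h3 : (1 - p) ^ k ≤ Real.exp (-(k * p)) := by
      have := Real.one_sub_le_exp_neg p
      calc (1 - p) ^ k ≤ Real.exp (-p) ^ k := pow_le_pow_left₀ (by linarith) this k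
        _ = _ := by rw [← Real.exp_nat_mul]; ring_nf
    have h4 : Real.exp (-(k * p)) * (1 + k * p) ≤ 1 := by
      have h5 := Real.add_one_le_exp (k * p)
      calc _ ≤ Real.exp (-(k * p)) * Real.exp (k * p) := by
            gcongr; linarith
        _ = 1 := by rw [← Real.exp_add]; simp
    refine h3.trans ?_
    by_contra hcon
    push Not at hcon
    nlinarith
  have h6 := Real.one_sub_le_exp_neg (k * p / 4)
  rw [pow_add]
  nlinarith

theorem prob_not_isExpanding_le (hp0 : 0 ≤ p) (hp1 : p ≤ 1) {M ℓ : ℕ}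
    (hℓ : ℓ * p ≤ 1 / 2) (hMℓ : 2 * ((1 + 2 * M) * ℓ) ≤ n)
    (hM : (1 + 2 * M) * Real.log (n + 1) ≤ p * n / 16) :
    prob n p (fun G => ¬ IsExpanding G M ℓ) ≤ n * Real.exp (-(p * n / 16)) := by
  let small : ℕ → Finset (Finset (Fin n)) := fun j => Finset.univ.filter (fun s => s.card ≤ j)
  let bad : Finset (Fin n) → Finset (Fin n) → Finset (Fin n) → SimpleGraph (Fin n) → Prop :=
    fun A U T G => ∀ w, w ∉ A → w ∉ U → w ∉ T →
        ¬ ((∃ a ∈ A, G.Adj w a) ∧ ∀ u ∈ U, ¬ G.Adj w u)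
  let K : ℕ → Finset (Finset (Fin n) × Finset (Fin n) × Finset (Fin n)) := fun k =>
    (small k ×ˢ small (M * k) ×ˢ small (M * k)).filter
      (fun q => q.1.card = k ∧ Disjoint q.1 q.2.1 ∧ q.2.1.card ≤ ℓ)
  have hstep : prob n p (fun G => ¬ IsExpanding G M ℓ) ≤
      prob n p (fun G => ∃ k ∈ (Finset.Icc 1 n).filter (· ≤ ℓ),
        ∃ q ∈ K k, bad q.1 q.2.1 q.2.2 G) := by
    refine prob_mono hp0 hp1 fun G hG => ?_
    unfold IsExpanding at hG
    push Not at hG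
    obtain ⟨A, U, T, hA, hAU, hAℓ, hUℓ, hUM, hTM, h⟩ := hG
    have hAn : A.card ≤ n := (Finset.card_le_univ A).trans_eq (Fintype.card_fin n)
    refine ⟨A.card, ?_, (A, U, T), ?_, ?_⟩
    · simp only [Finset.mem_filter, Finset.mem_Icc]
      exact ⟨⟨hA.card_pos, hAn⟩, hAℓ⟩
    · simp [K, small, hAU, hUℓ, hUM, hTM]
    · rintro w h1 h2 h3 ⟨⟨a, ha, haw⟩, h4⟩
      obtain ⟨u, hu, hwu⟩ := h w h1 h2 h3 ⟨a, ha, haw⟩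
      exact h4 u hu hwu
  have hk : ∀ k ∈ (Finset.Icc 1 n).filter (· ≤ ℓ),
      prob n p (fun G => ∃ q ∈ K k, bad q.1 q.2.1 q.2.2 G) ≤ Real.exp (-(p * n / 16)) := by
    intro k hk
    simp only [Finset.mem_filter, Finset.mem_Icc] at hk
    obtain ⟨⟨hk1, hkn⟩, hkℓ⟩ := hk
    have hkℓ' : (k : ℝ) ≤ ℓ := by exact_mod_cast hkℓ
    have hkp : (k : ℝ) * p ≤ 1 := by nlinarith
    have hone : ∀ q ∈ K k, prob n p (bad q.1 q.2.1 q.2.2) ≤ Real.exp (-(k * (p * n / 8))) := by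
      rintro ⟨A, U, T⟩ hq
      simp only [K, small, Finset.mem_filter, Finset.mem_product, Finset.mem_univ, true_and] at hq
      obtain ⟨⟨-, hU, hT⟩, hA, hAU, hUℓ⟩ := hq
      refine (prob_forall_not_expand_le hp0 hp1 A U T hAU).trans ?_
      have hUℓ' : (U.card : ℝ) ≤ ℓ := by exact_mod_cast hUℓ
      have hb := one_sub_pow_add_pow_le hp0 hp1 (k := A.card) (u := U.card) (by rw [hA]; exact hkp)
        (by nlinarith)
      have hnn : 0 ≤ 1 - (1 - p) ^ U.card + (1 - p) ^ (A.card + U.card) := by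
        have h1 : (1 - p) ^ U.card ≤ 1 := pow_le_one₀ (by linarith) (by linarith)
        have h2 : 0 ≤ (1 - p) ^ (A.card + U.card) := pow_nonneg (by linarith) _
        linarith
      have hcard : (n : ℝ) / 2 ≤ ((Finset.univ \ (A ∪ U ∪ T)).card : ℝ) := by
        have h1 := Finset.le_card_sdiff (A ∪ U ∪ T) (Finset.univ : Finset (Fin n))
        rw [Finset.card_univ, Fintype.card_fin] at h1
        have h2 : (A ∪ U ∪ T).card ≤ A.card + U.card + T.card :=
          (Finset.card_union_le _ _).trans (Nat.add_le_add_right (Finset.card_union_le _ _) _)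
        have h3 : (1 + 2 * M) * k ≤ (1 + 2 * M) * ℓ := Nat.mul_le_mul_left _ hkℓ
        have h4 : n ≤ 2 * (Finset.univ \ (A ∪ U ∪ T)).card := by
          have h5 : (1 + 2 * M) * k = k + M * k + M * k := by ring
          omega
        have h6 : (n : ℝ) ≤ 2 * ((Finset.univ \ (A ∪ U ∪ T)).card : ℝ) := by exact_mod_cast h4
        linarith
      refine (pow_le_pow_left₀ hnn hb _).trans ?_
      rw [← Real.exp_nat_mul, Real.exp_le_exp, hA]
      have hx : 0 ≤ (k : ℝ) * p / 4 := by positivity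
      nlinarith [mul_le_mul_of_nonneg_right hcard hx]
    refine (prob_exists_le hp0 hp1 _ _).trans ((Finset.sum_le_sum hone).trans ?_)
    rw [Finset.sum_const, nsmul_eq_mul]
    have hKc : ((K k).card : ℝ) ≤ ((n : ℝ) + 1) ^ ((1 + 2 * M) * k) := by
      have h1 : (K k).card ≤ (n + 1) ^ ((1 + 2 * M) * k) := by
        calc (K k).card ≤ (small k ×ˢ small (M * k) ×ˢ small (M * k)).card :=
              Finset.card_filter_le _ _
          _ = (small k).card * ((small (M * k)).card * (small (M * k)).card) := by
              rw [Finset.card_product, Finset.card_product]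
          _ ≤ (n + 1) ^ k * ((n + 1) ^ (M * k) * (n + 1) ^ (M * k)) := by
              gcongr <;> exact card_filter_card_le n _
          _ = _ := by ring
      exact_mod_cast h1
    have hpow : ((n : ℝ) + 1) ^ ((1 + 2 * M) * k) =
        Real.exp (k * ((1 + 2 * M) * Real.log (n + 1))) := by
      rw [← Real.exp_log (show (0 : ℝ) < (n : ℝ) + 1 by positivity), ← Real.exp_nat_mul,
        Real.log_exp]
      push_cast
      ring_nf
    rw [hpow] at hKc
    calc _ ≤ _ := mul_le_mul_of_nonneg_right hKc (Real.exp_pos _).le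
      _ ≤ _ := by
        rw [← Real.exp_add, Real.exp_le_exp]
        have hk1' : (1 : ℝ) ≤ k := by exact_mod_cast hk1
        have hpn : 0 ≤ p * n / 16 := by positivity
        nlinarith
  refine hstep.trans ((prob_exists_le hp0 hp1 _ _).trans ((Finset.sum_le_sum hk).trans ?_))
  rw [Finset.sum_const, nsmul_eq_mul]
  refine mul_le_mul_of_nonneg_right ?_ (Real.exp_pos _).le
  have h1 := Finset.card_filter_le (Finset.Icc 1 n) (· ≤ ℓ)
  rw [Nat.card_Icc, Nat.add_sub_cancel] at h1
  exact_mod_cast h1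

theorem prob_forall_not_adj_le (hp0 : 0 ≤ p) (hp1 : p ≤ 1) (A B : Finset (Fin n))
    (hAB : Disjoint A B) :
    prob n p (fun G => ∀ a ∈ A, ∀ b ∈ B, ¬ G.Adj a b) ≤ Real.exp (-(A.card * B.card * p)) := by
  have hne : ∀ a ∈ A, ∀ b ∈ B, a ≠ b := fun a ha b hb h =>
    Finset.disjoint_left.1 hAB ha (h ▸ hb)
  let F : Finset (Sym2 (Fin n)) := (A ×ˢ B).image (fun q => s(q.1, q.2))
  have hF : F ⊆ (⊤ : SimpleGraph (Fin n)).edgeFinset := by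
    intro e he
    obtain ⟨⟨a, b⟩, hab, rfl⟩ := Finset.mem_image.1 he
    simpa using hne a (Finset.mem_product.1 hab).1 b (Finset.mem_product.1 hab).2
  have hcard : F.card = A.card * B.card := by
    rw [Finset.card_image_of_injOn, Finset.card_product]
    rintro ⟨a, b⟩ hab ⟨a', b'⟩ hab' h
    simp only [Finset.coe_product, Set.mem_prod, Finset.mem_coe] at hab hab'
    simp only [Sym2.eq_iff] at h
    rcases h with ⟨rfl, rfl⟩ | ⟨h1, h2⟩
    · rfl
    · exact absurd h1 (hne a hab.1 b' hab'.2)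
  have hle : prob n p (fun G => ∀ a ∈ A, ∀ b ∈ B, ¬ G.Adj a b) ≤ (1 - p) ^ F.card := by
    rw [prob_eq_subsetExp, ← subsetExp_disjoint hF]
    refine subsetExp_mono hp0 hp1 fun s _ => ?_
    have : (∀ a ∈ A, ∀ b ∈ B,
        ¬ (SimpleGraph.fromEdgeSet (s : Set (Sym2 (Fin n)))).Adj a b) → Disjoint s F := by
      intro h
      rw [Finset.disjoint_left]
      intro e hes heF
      obtain ⟨⟨a, b⟩, hab, rfl⟩ := Finset.mem_image.1 heF
      have hab := Finset.mem_product.1 hab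
      refine h a hab.1 b hab.2 ?_
      rw [SimpleGraph.fromEdgeSet_adj]
      exact ⟨hes, hne a hab.1 b hab.2⟩
    split_ifs <;> first | (norm_num; done) | tauto
  refine hle.trans ?_
  calc (1 - p) ^ F.card ≤ Real.exp (-p) ^ F.card :=
        pow_le_pow_left₀ (by linarith) (Real.one_sub_le_exp_neg p) _
    _ = _ := by rw [← Real.exp_nat_mul, hcard]; push_cast; ring_nf

theorem prob_not_isJoining_le (hp0 : 0 ≤ p) (hp1 : p ≤ 1) {s : ℕ} (hs : 1 ≤ s)
    (h : 2 * Real.log (n + 1) ≤ p * s / 2) :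
    prob n p (fun G => ¬ IsJoining G s) ≤ Real.exp (-(p * s / 2)) := by
  let small : Finset (Finset (Fin n)) := Finset.univ.filter (fun t => t.card ≤ s)
  let K : Finset (Finset (Fin n) × Finset (Fin n)) :=
    (small ×ˢ small).filter (fun q => Disjoint q.1 q.2 ∧ q.1.card = s ∧ q.2.card = s)
  have hstep : prob n p (fun G => ¬ IsJoining G s) ≤
      prob n p (fun G => ∃ q ∈ K, ∀ a ∈ q.1, ∀ b ∈ q.2, ¬ G.Adj a b) := by
    refine prob_mono hp0 hp1 fun G hG => ?_
    unfold IsJoining at hG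
    push Not at hG
    obtain ⟨A, B, hAB, hA, hB, hadj⟩ := hG
    exact ⟨(A, B), by simp [K, small, hAB, hA, hB], hadj⟩
  have hone : ∀ q ∈ K, prob n p (fun G => ∀ a ∈ q.1, ∀ b ∈ q.2, ¬ G.Adj a b) ≤
      Real.exp (-(s * s * p)) := by
    rintro ⟨A, B⟩ hq
    obtain ⟨-, hAB, hA, hB⟩ := Finset.mem_filter.1 hq
    have := prob_forall_not_adj_le hp0 hp1 A B hAB
    dsimp only at hA hB
    rwa [hA, hB] at this
  refine hstep.trans ((prob_exists_le hp0 hp1 _ _).trans ((Finset.sum_le_sum hone).trans ?_))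
  rw [Finset.sum_const, nsmul_eq_mul]
  have hKc : (K.card : ℝ) ≤ ((n : ℝ) + 1) ^ (2 * s) := by
    have h1 : K.card ≤ (n + 1) ^ (2 * s) := by
      calc K.card ≤ (small ×ˢ small).card := Finset.card_filter_le _ _
        _ = small.card * small.card := Finset.card_product _ _
        _ ≤ (n + 1) ^ s * (n + 1) ^ s := by
            gcongr <;> exact card_filter_card_le n _
        _ = _ := by ring
    exact_mod_cast h1
  have hpow : ((n : ℝ) + 1) ^ (2 * s) = Real.exp (s * (2 * Real.log (n + 1))) := by
    rw [← Real.exp_log (show (0 : ℝ) < (n : ℝ) + 1 by positivity), ← Real.exp_nat_mul,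
      Real.log_exp]
    push_cast
    ring_nf
  rw [hpow] at hKc
  calc _ ≤ _ := mul_le_mul_of_nonneg_right hKc (Real.exp_pos _).le
    _ ≤ _ := by
      rw [← Real.exp_add, Real.exp_le_exp]
      have hs' : (1 : ℝ) ≤ s := by exact_mod_cast hs
      have hps : 0 ≤ p * s / 2 := by positivity
      nlinarith

end RandomGraph

/-! ### Induced paths between prescribed vertices -/

/-- There is an induced path with `L` edges from `x` to `y` whose inner vertices are neither in
`U` nor adjacent to a vertex of `U`. -/
def HasInducedPath {V : Type*} (G : SimpleGraph V) (U : Finset V) (L : ℕ) (x y : V) : Prop :=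
  ∃ z : ℕ → V, z 0 = x ∧ z L = y ∧
    (∀ i j, i < j → j ≤ L → z i ≠ z j ∧ (G.Adj (z i) (z j) ↔ j = i + 1)) ∧
    ∀ i, 0 < i → i < L → z i ∉ U ∧ ∀ u ∈ U, ¬ G.Adj (z i) u

section InducedPath

variable {V : Type*} {G : SimpleGraph V}

theorem HasInducedPath.anti {U U' : Finset V} {L : ℕ} {x y : V} (h : HasInducedPath G U L x y)
    (hU : U' ⊆ U) : HasInducedPath G U' L x y := by
  obtain ⟨z, h0, hL, hz, hzU⟩ := h
  refine ⟨z, h0, hL, hz, fun i hi hiL => ?_⟩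
  obtain ⟨h1, h2⟩ := hzU i hi hiL
  exact ⟨fun h => h1 (hU h), fun u hu => h2 u (hU hu)⟩

theorem HasInducedPath.symm {U : Finset V} {L : ℕ} {x y : V} (h : HasInducedPath G U L x y) :
    HasInducedPath G U L y x := by
  obtain ⟨z, h0, hL, hz, hzU⟩ := h
  refine ⟨fun i => z (L - i), by simpa using hL, by simpa using h0, fun i j hij hj => ?_,
    fun i hi hiL => hzU _ (by omega) (by omega)⟩
  obtain ⟨h1, h2⟩ := hz (L - j) (L - i) (by omega) (by omega)
  refine ⟨h1.symm, ?_⟩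
  rw [G.adj_comm, h2]
  omega

variable [DecidableEq V]

theorem HasInducedPath.cons {U : Finset V} {L : ℕ} {x x' y : V}
    (h : HasInducedPath G (insert x U) L x' y) (hadj : G.Adj x x') (hxy : x ≠ y)
    (hnadj : ¬ G.Adj x y) (hx' : x' ∉ U) (hx'U : ∀ u ∈ U, ¬ G.Adj x' u) :
    HasInducedPath G U (L + 1) x y := by
  obtain ⟨z, h0, hL, hz, hzU⟩ := h
  have hL0 : L ≠ 0 := by
    rintro rfl
    exact hnadj ((h0.symm.trans hL) ▸ hadj)
  have hx : ∀ j, j ≤ L → x ≠ z j ∧ (G.Adj x (z j) ↔ j = 0) := by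
    intro j hj
    rcases Nat.eq_zero_or_pos j with rfl | hj0
    · rw [h0]; exact ⟨hadj.ne, by simp [hadj]⟩
    · rcases hj.eq_or_lt with rfl | hjL
      · rw [hL]; exact ⟨hxy, by simp [hnadj, hL0]⟩
      · obtain ⟨h1, h2⟩ := hzU j hj0 hjL
        refine ⟨fun h => h1 (h ▸ Finset.mem_insert_self _ _), ?_⟩
        have h3 := h2 x (Finset.mem_insert_self _ _)
        rw [G.adj_comm] at h3
        simp only [h3, false_iff]
        omega
  refine ⟨fun i => Nat.casesOn i x z, rfl, hL, ?_, ?_⟩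
  · rintro (_ | i) (_ | j) hij hj
    · omega
    · have := hx j (by omega)
      simpa using this
    · omega
    · have := hz i j (by omega) (by omega)
      simpa using this
  · rintro (_ | i) hi hiL
    · omega
    · rcases Nat.eq_zero_or_pos i with rfl | hi0
      · change z 0 ∉ U ∧ ∀ u ∈ U, ¬ G.Adj (z 0) u
        rw [h0]; exact ⟨hx', hx'U⟩
      · obtain ⟨h1, h2⟩ := hzU i hi0 (by omega)
        exact ⟨fun h => h1 (Finset.mem_insert_of_mem h),
          fun u hu => h2 u (Finset.mem_insert_of_mem hu)⟩

theorem IsExpanding.exists_finset {M ℓ : ℕ} (hG : IsExpanding G M ℓ) (N : ℕ)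
    {A U T : Finset V} (hA : A.Nonempty) (hAU : Disjoint A U) (hAℓ : A.card ≤ ℓ)
    (hUℓ : U.card ≤ ℓ) (hUM : U.card ≤ M * A.card) (hTM : T.card + N ≤ M * A.card) :
    ∃ A' : Finset V, A'.card = N ∧ Disjoint A' A ∧ Disjoint A' U ∧ Disjoint A' T ∧
      ∀ w ∈ A', (∃ a ∈ A, G.Adj a w) ∧ ∀ u ∈ U, ¬ G.Adj w u := by
  induction N with
  | zero => exact ⟨∅, by simp⟩
  | succ N ih =>
    obtain ⟨A', hc, h1, h2, h3, h4⟩ := ih (by omega)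
    obtain ⟨w, hwA, hwU, hwT, ⟨a, ha, haw⟩, hw⟩ := hG A U (T ∪ A') hA hAU hAℓ hUℓ hUM
      (by have := Finset.card_union_le T A'; omega)
    rw [Finset.mem_union, not_or] at hwT
    refine ⟨insert w A', by rw [Finset.card_insert_of_notMem hwT.2, hc], ?_, ?_, ?_, ?_⟩
    · exact Finset.disjoint_insert_left.2 ⟨hwA, h1⟩
    · exact Finset.disjoint_insert_left.2 ⟨hwU, h2⟩
    · exact Finset.disjoint_insert_left.2 ⟨hwT.1, h3⟩
    · intro v hv
      rcases Finset.mem_insert.1 hv with rfl | hv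
      · exact ⟨⟨a, ha, haw.symm⟩, hw⟩
      · exact h4 v hv

/-- In an expanding and joining graph, two small sets of vertices are joined by a short induced
path avoiding a given small set together with its neighbours: grow both sets by neighbourhoods
until they are so large that there has to be an edge between them. -/
theorem IsExpanding.exists_hasInducedPath {m D t : ℕ} (hD : 2 ≤ D)
    (hG : IsExpanding G (m + 8 * D) (m + 4 * D ^ (t - 1))) (hJ : IsJoining G (D ^ t))
    (j : ℕ) {k : ℕ} (hk0 : 1 ≤ k) (hk : k * D ^ j = D ^ t) {A B U : Finset V}
    (hA : A.card = k) (hB : B.card = k) (hAB : Disjoint A B) (hAU : Disjoint A U)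
    (hBU : Disjoint B U) (hU : U.card ≤ m + 2 * k)
    (hne : j ≠ 0 → ∀ a ∈ A, ∀ b ∈ B, ¬ G.Adj a b) :
    ∃ a ∈ A, ∃ b ∈ B, HasInducedPath G U (2 * j + 1) a b := by
  induction j generalizing k A B U with
  | zero =>
    obtain ⟨a, ha, b, hb, hab⟩ := hJ A B hAB (by rw [hA, ← hk]; simp) (by rw [hB, ← hk]; simp)
    refine ⟨a, ha, b, hb, fun i => if i = 0 then a else b, by simp, by simp, ?_, ?_⟩
    · intro i j hij hj
      obtain rfl : i = 0 := by omega
      obtain rfl : j = 1 := by omega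
      simpa [hab] using hab.ne
    · intro i hi hi'
      omega
  | succ j ih =>
    have hDpos : 0 < D := by omega
    have ht : t ≠ 0 := by
      rintro rfl
      have h1 : D ^ (j + 1) ≤ k * D ^ (j + 1) := Nat.le_mul_of_pos_left _ hk0
      have h2 : D ≤ D ^ (j + 1) := Nat.le_self_pow (by omega) D
      simp at hk
      omega
    have hk' : k * D ^ j = D ^ (t - 1) := by
      obtain ⟨t', rfl⟩ := Nat.exists_eq_succ_of_ne_zero ht
      apply Nat.eq_of_mul_eq_mul_right hDpos
      rw [Nat.succ_sub_one, ← pow_succ, ← hk, pow_succ, mul_assoc]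
    have hkt : k ≤ D ^ (t - 1) := by
      rw [← hk']; exact Nat.le_mul_of_pos_right _ (by positivity)
    have hkD : 2 * k ≤ D * k := Nat.mul_le_mul_right _ hD
    have hm : m ≤ m * k := Nat.le_mul_of_pos_right _ hk0
    have hM : (m + 8 * D) * k = m * k + 8 * (D * k) := by ring
    have hDkt : j ≠ 0 → D * k ≤ D ^ (t - 1) := by
      intro hj
      rw [← hk', mul_comm]
      exact Nat.mul_le_mul_left _ (Nat.le_self_pow hj D)
    have hAB' : ∀ a ∈ A, ∀ b ∈ B, ¬ G.Adj a b := hne (by omega)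
    have hUB : (U ∪ B).card ≤ m + 3 * k := by
      have := Finset.card_union_le U B; omega
    have hUA : (U ∪ A).card ≤ m + 3 * k := by
      have := Finset.card_union_le U A; omega
    obtain ⟨A', hA'c, hA'A, hA'UB, -, hA'⟩ := hG.exists_finset (D * k) (A := A) (U := U ∪ B)
      (T := ∅) (Finset.card_pos.1 (by omega)) (Finset.disjoint_union_right.2 ⟨hAU, hAB⟩)
      (by omega) (by omega) (by rw [hA, hM]; omega) (by rw [hA, hM, Finset.card_empty]; omega)
    rw [Finset.disjoint_union_right] at hA'UB
    have hUAA : (U ∪ A ∪ A').card ≤ m + 3 * k + D * k := by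
      have := Finset.card_union_le (U ∪ A) A'; omega
    obtain ⟨B', hB'c, hB'B, hB'UA, hB'A', hB', hB'j⟩ : ∃ B' : Finset V, B'.card = D * k ∧
        Disjoint B' B ∧ Disjoint B' (U ∪ A) ∧ Disjoint B' A' ∧
        (∀ w ∈ B', (∃ b ∈ B, G.Adj b w) ∧ ∀ u ∈ U ∪ A, ¬ G.Adj w u) ∧
        (j ≠ 0 → ∀ w ∈ B', ∀ a ∈ A', ¬ G.Adj w a) := by
      by_cases hj : j = 0
      · obtain ⟨B', h1, h2, h3, h4, h5⟩ := hG.exists_finset (D * k) (A := B) (U := U ∪ A)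
          (T := A') (Finset.card_pos.1 (by omega))
          (Finset.disjoint_union_right.2 ⟨hBU, hAB.symm⟩)
          (by omega) (by omega) (by rw [hB, hM]; omega) (by rw [hB, hM]; omega)
        exact ⟨B', h1, h2, h3, h4, h5, fun h => absurd hj h⟩
      · have := hDkt hj
        obtain ⟨B', h1, h2, h3, -, h5⟩ := hG.exists_finset (D * k) (A := B) (U := U ∪ A ∪ A')
          (T := ∅) (Finset.card_pos.1 (by omega))
          (Finset.disjoint_union_right.2
            ⟨Finset.disjoint_union_right.2 ⟨hBU, hAB.symm⟩, hA'UB.2.symm⟩)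
          (by omega) (by omega) (by rw [hB, hM]; omega)
          (by rw [hB, hM, Finset.card_empty]; omega)
        rw [Finset.disjoint_union_right] at h3
        exact ⟨B', h1, h2, h3.1, h3.2,
          fun w hw => ⟨(h5 w hw).1, fun u hu => (h5 w hw).2 u (Finset.mem_union_left _ hu)⟩,
          fun _ w hw a ha => (h5 w hw).2 a (Finset.mem_union_right _ ha)⟩
    rw [Finset.disjoint_union_right] at hB'UA
    obtain ⟨a', ha', b', hb', hP⟩ := ih (k := D * k) (A := A') (B := B') (U := U ∪ A ∪ B)
      (Nat.mul_pos hDpos hk0) (by rw [← hk, pow_succ]; ring) hA'c hB'c hB'A'.symm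
      (by simp only [Finset.disjoint_union_right]; exact ⟨⟨hA'UB.1, hA'A⟩, hA'UB.2⟩)
      (by simp only [Finset.disjoint_union_right]; exact ⟨⟨hB'UA.1, hB'UA.2⟩, hB'B⟩)
      (by have := Finset.card_union_le (U ∪ A) B; omega)
      (fun hj a ha b hb h => hB'j hj b hb a ha h.symm)
    obtain ⟨⟨a, ha, haa'⟩, ha'U⟩ := hA' a' ha'
    obtain ⟨⟨b, hb, hbb'⟩, hb'U⟩ := hB' b' hb'
    refine ⟨a, ha, b, hb, ?_⟩
    have h1 : HasInducedPath G (insert a (insert b U)) (2 * j + 1) a' b' := by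
      refine hP.anti fun v hv => ?_
      simp only [Finset.mem_insert, Finset.mem_union] at hv ⊢
      rcases hv with rfl | rfl | hv <;> tauto
    have h2 : HasInducedPath G (insert b U) (2 * j + 1 + 1) a b' := by
      refine h1.cons haa' ?_ ?_ ?_ ?_
      · rintro rfl
        exact Finset.disjoint_left.1 hB'UA.2 hb' ha
      · exact fun h => hb'U a (Finset.mem_union_right _ ha) h.symm
      · rw [Finset.mem_insert, not_or]
        exact ⟨fun h => Finset.disjoint_left.1 hA'UB.2 ha' (h ▸ hb),
          Finset.disjoint_left.1 hA'UB.1 ha'⟩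
      · intro u hu
        refine ha'U u ?_
        rcases Finset.mem_insert.1 hu with rfl | hu
        · exact Finset.mem_union_right _ hb
        · exact Finset.mem_union_left _ hu
    have h3 := h2.symm.cons hbb' (fun h => Finset.disjoint_left.1 hAB ha (h ▸ hb))
      (fun h => hAB' a ha b hb h.symm) (Finset.disjoint_left.1 hB'UA.1 hb')
      (fun u hu => hb'U u (Finset.mem_union_left _ hu))
    exact h3.symm

/-- In an expanding and joining graph, two non-adjacent vertices are joined by induced paths of
every prescribed, not too small length. -/
theorem IsExpanding.hasInducedPath {m D t : ℕ} (hD : 2 ≤ D)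
    (hG : IsExpanding G (m + 8 * D) (m + 4 * D ^ (t - 1))) (hJ : IsJoining G (D ^ t))
    (c : ℕ) {U : Finset V} (hU : U.card + c ≤ m) {x y : V} (hxy : x ≠ y) (hadj : ¬ G.Adj x y)
    (hx : x ∉ U) (hy : y ∉ U) : HasInducedPath G U (2 * t + 1 + c) x y := by
  induction c generalizing U x with
  | zero =>
    obtain ⟨a, ha, b, hb, h⟩ := hG.exists_hasInducedPath hD hJ t (k := 1) le_rfl (by simp)
      (A := {x}) (B := {y}) (U := U) (by simp) (by simp) (by simpa using hxy) (by simpa using hx)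
      (by simpa using hy) (by omega) (by simpa using fun _ => hadj)
    rw [Finset.mem_singleton] at ha hb
    exact ha ▸ hb ▸ h
  | succ c ih =>
    have hpos : 0 < D ^ (t - 1) := by positivity
    obtain ⟨x', -, hx'U, -, ⟨a, ha, hxx'⟩, hx'⟩ := hG {x} (insert y U) ∅ (by simp)
      (by simp [hxy, hx]) (by simp; omega)
      (by have := Finset.card_insert_le y U; omega)
      (by have := Finset.card_insert_le y U; rw [Finset.card_singleton]; omega) (by simp)
    rw [Finset.mem_singleton] at ha
    subst ha
    rw [Finset.mem_insert, not_or] at hx'U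
    refine (ih (U := insert a U) (x := x') ?_ hx'U.1 (hx' y (Finset.mem_insert_self _ _)) ?_ ?_).cons
      hxx'.symm hxy hadj hx'U.2 (fun u hu => hx' u (Finset.mem_insert_of_mem hu))
    · have := Finset.card_insert_le a U; omega
    · rw [Finset.mem_insert, not_or]
      exact ⟨hxx'.ne, hx'U.2⟩
    · rw [Finset.mem_insert, not_or]
      exact ⟨hxy.symm, hy⟩

end InducedPath

/-! ### Building induced copies step by step -/

/-- The subgraph of `H` induced on `S` embeds into `G` as an induced subgraph. -/
def EmbedsOn {V W : Type*} (H : SimpleGraph W) (G : SimpleGraph V) (S : Finset W) : Prop :=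
  ∃ f : W → V, Set.InjOn f S ∧ ∀ x ∈ S, ∀ y ∈ S, (G.Adj (f x) (f y) ↔ H.Adj x y)

section Embedding

variable {V W : Type*} [DecidableEq V] [DecidableEq W] {H : SimpleGraph W} {G : SimpleGraph V}

theorem EmbedsOn.insert [Fintype V] {S : Finset W} (hS : EmbedsOn H G S) {M ℓ : ℕ}
    (hG : IsExpanding G M ℓ) (hℓ : 1 ≤ ℓ) (hSℓ : S.card ≤ ℓ) (hSM : S.card ≤ M)
    (hSV : S.card < Fintype.card V) {v : W} (hv : v ∉ S)
    (huniq : ∀ x ∈ S, ∀ y ∈ S, H.Adj v x → H.Adj v y → x = y) : EmbedsOn H G (insert v S) := by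
  obtain ⟨f, hf, hadj⟩ := hS
  have hext : ∀ w, w ∉ S.image f → (∀ x ∈ S, (G.Adj w (f x) ↔ H.Adj v x)) →
      EmbedsOn H G (Insert.insert v S) := by
    intro w hw hwadj
    have hne : ∀ x ∈ S, x ≠ v := fun x hx h => hv (h ▸ hx)
    have hwne : ∀ x ∈ S, f x ≠ w := fun x hx h => hw (h ▸ Finset.mem_image_of_mem f hx)
    refine ⟨Function.update f v w, ?_, ?_⟩
    · intro x hx y hy hxy
      rw [Finset.mem_coe, Finset.mem_insert] at hx hy
      rcases hx with rfl | hx <;> rcases hy with rfl | hy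
      · rfl
      · rw [Function.update_self, Function.update_of_ne (hne y hy)] at hxy
        exact absurd hxy.symm (hwne y hy)
      · rw [Function.update_self, Function.update_of_ne (hne x hx)] at hxy
        exact absurd hxy (hwne x hx)
      · rw [Function.update_of_ne (hne x hx), Function.update_of_ne (hne y hy)] at hxy
        exact hf hx hy hxy
    · intro x hx y hy
      rw [Finset.mem_insert] at hx hy
      rcases hx with rfl | hx <;> rcases hy with rfl | hy
      · simp
      · rw [Function.update_self, Function.update_of_ne (hne y hy)]
        exact hwadj y hy
      · rw [Function.update_self, Function.update_of_ne (hne x hx), G.adj_comm, H.adj_comm]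
        exact hwadj x hx
      · rw [Function.update_of_ne (hne x hx), Function.update_of_ne (hne y hy)]
        exact hadj x hx y hy
  have hcard : (S.image f).card ≤ S.card := Finset.card_image_le
  by_cases hx : ∃ x ∈ S, H.Adj v x
  · obtain ⟨x, hxS, hvx⟩ := hx
    have hU : ((S.image f).erase (f x)).card ≤ (S.image f).card := Finset.card_erase_le
    obtain ⟨w, hw1, hw2, -, ⟨a, ha, hwa⟩, hw3⟩ := hG {f x} ((S.image f).erase (f x)) ∅ (by simp)
      (by simp) (by simpa using hℓ) (by omega) (by rw [Finset.card_singleton]; omega) (by simp)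
    rw [Finset.mem_singleton] at hw1 ha
    subst ha
    refine hext w (fun h => hw2 (Finset.mem_erase.2 ⟨hw1, h⟩)) fun y hy => ?_
    by_cases hyx : y = x
    · subst hyx
      simp [hwa, hvx]
    · have h1 : ¬ H.Adj v y := fun h => hyx (huniq y hy x hxS h hvx)
      have h2 : ¬ G.Adj w (f y) := hw3 _ (Finset.mem_erase.2
        ⟨fun h => hyx (hf hy hxS h), Finset.mem_image_of_mem f hy⟩)
      simp [h1, h2]
  · push Not at hx
    obtain ⟨z, hz⟩ : ∃ z, z ∉ S.image f := by
      by_contra! h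
      have : S.image f = Finset.univ := Finset.eq_univ_iff_forall.2 h
      rw [this, Finset.card_univ] at hcard
      omega
    obtain ⟨w, -, hw2, -, -, hw3⟩ := hG {z} (S.image f) ∅ (by simp)
      (by simpa using hz) (by simpa using hℓ) (by omega) (by rw [Finset.card_singleton]; omega)
      (by simp)
    exact hext w hw2 fun y hy =>
      ⟨fun h => absurd h (hw3 _ (Finset.mem_image_of_mem f hy)), fun h => absurd h (hx y hy)⟩

theorem EmbedsOn.union_path {S : Finset W} (hS : EmbedsOn H G S) {γ m : ℕ}
    (hG : ∀ (U : Finset V) (x y : V), U.card ≤ m → x ≠ y → ¬ G.Adj x y → x ∉ U → y ∉ U →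
      HasInducedPath G U (γ + 1) x y)
    (hSm : S.card ≤ m) {q : Fin γ → W} (hq : Function.Injective q) (hqS : ∀ k, q k ∉ S)
    {x y : W} (hx : x ∈ S) (hy : y ∈ S) (hxy : x ≠ y) (hnadj : ¬ H.Adj x y)
    (hqq : ∀ k l : Fin γ, H.Adj (q k) (q l) ↔ (l : ℕ) = k + 1 ∨ (k : ℕ) = l + 1)
    (hqw : ∀ k, ∀ w ∈ S, (H.Adj (q k) w ↔ (k : ℕ) = 0 ∧ w = x ∨ (k : ℕ) + 1 = γ ∧ w = y)) :
    EmbedsOn H G (S ∪ Finset.univ.image q) := by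
  obtain ⟨f, hf, hadj⟩ := hS
  have hU : (((S.image f).erase (f x)).erase (f y)).card ≤ m :=
    Finset.card_erase_le.trans (Finset.card_erase_le.trans (Finset.card_image_le.trans hSm))
  obtain ⟨z, hz0, hzL, hz, hzU⟩ := hG _ (f x) (f y) hU (fun h => hxy (hf hx hy h))
    (by rwa [hadj x hx y hy]) (by simp) (by simp)
  have hinner : ∀ k : Fin γ, ∀ w ∈ S, z (k + 1) ≠ f w ∧
      (G.Adj (z (k + 1)) (f w) ↔ (k : ℕ) = 0 ∧ w = x ∨ (k : ℕ) + 1 = γ ∧ w = y) := by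
    intro k w hw
    have hk := k.2
    by_cases hwx : w = x
    · subst hwx
      rw [← hz0]
      obtain ⟨h1, h2⟩ := hz 0 (k + 1) (by omega) (by omega)
      refine ⟨h1.symm, ?_⟩
      rw [G.adj_comm, h2]
      simp [hxy]
    · by_cases hwy : w = y
      · subst hwy
        rw [← hzL]
        obtain ⟨h1, h2⟩ := hz (k + 1) (γ + 1) (by omega) (by omega)
        refine ⟨h1, ?_⟩
        rw [h2]
        simp only [hxy.symm, and_false, and_true, false_or]
        omega
      · have hmem : f w ∈ ((S.image f).erase (f x)).erase (f y) := by
          simp only [Finset.mem_erase]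
          exact ⟨fun h => hwy (hf hw hy h), fun h => hwx (hf hw hx h),
            Finset.mem_image_of_mem f hw⟩
        obtain ⟨h1, h2⟩ := hzU (k + 1) (by omega) (by omega)
        refine ⟨fun h => h1 (h ▸ hmem), ?_⟩
        simp [h2 _ hmem, hwx, hwy]
  have hpath : ∀ k l : Fin γ, (z (k + 1) = z (l + 1) → k = l) ∧
      (G.Adj (z (k + 1)) (z (l + 1)) ↔ (l : ℕ) = k + 1 ∨ (k : ℕ) = l + 1) := by
    intro k l
    have hk := k.2
    have hl := l.2
    rcases lt_trichotomy (k : ℕ) l with h | h | h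
    · obtain ⟨h1, h2⟩ := hz (k + 1) (l + 1) (by omega) (by omega)
      refine ⟨fun h => absurd h h1, ?_⟩
      rw [h2]
      omega
    · have : k = l := Fin.ext h
      subst this
      simp
    · obtain ⟨h1, h2⟩ := hz (l + 1) (k + 1) (by omega) (by omega)
      refine ⟨fun h => absurd h.symm h1, ?_⟩
      rw [G.adj_comm, h2]
      omega
  let g : W → V := Function.extend q (fun k => z (k + 1)) f
  have hgq : ∀ k, g (q k) = z (k + 1) := fun k => hq.extend_apply _ _ k
  have hgS : ∀ w ∈ S, g w = f w := fun w hw =>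
    Function.extend_apply' _ _ _ fun ⟨k, hk⟩ => hqS k (hk ▸ hw)
  have hmem : ∀ w, w ∈ S ∪ Finset.univ.image q ↔ w ∈ S ∨ ∃ k, q k = w := by simp
  refine ⟨g, ?_, ?_⟩
  · intro u hu w hw huw
    rw [Finset.mem_coe, hmem] at hu hw
    rcases hu with hu | ⟨k, rfl⟩ <;> rcases hw with hw | ⟨l, rfl⟩
    · rw [hgS u hu, hgS w hw] at huw
      exact hf hu hw huw
    · rw [hgS u hu, hgq] at huw
      exact absurd huw.symm (hinner l u hu).1
    · rw [hgS w hw, hgq] at huw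
      exact absurd huw (hinner k w hw).1
    · rw [hgq, hgq] at huw
      rw [(hpath k l).1 huw]
  · intro u hu w hw
    rw [hmem] at hu hw
    rcases hu with hu | ⟨k, rfl⟩ <;> rcases hw with hw | ⟨l, rfl⟩
    · rw [hgS u hu, hgS w hw]
      exact hadj u hu w hw
    · rw [hgS u hu, hgq, G.adj_comm, H.adj_comm, (hinner l u hu).2, hqw l u hu]
    · rw [hgS w hw, hgq, (hinner k w hw).2, hqw k w hw]
    · rw [hgq, hgq, (hpath k l).2, hqq]

/-- A finite set of vertices spanning a forest, presented by a ranking in which every vertex has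
at most one neighbour of smaller rank, embeds into an expanding graph. -/
theorem EmbedsOn.of_rank [Fintype V] [Nonempty V] {M ℓ : ℕ} (hG : IsExpanding G M ℓ) (hℓ : 1 ≤ ℓ)
    {S : Finset W} (hSℓ : S.card ≤ ℓ) (hSM : S.card ≤ M) (hSV : S.card ≤ Fintype.card V)
    (rank : W → ℕ) (hrank : Set.InjOn rank S)
    (huniq : ∀ v ∈ S, ∀ x ∈ S, ∀ y ∈ S, rank x < rank v → rank y < rank v →
      H.Adj v x → H.Adj v y → x = y) : EmbedsOn H G S := by
  have key : ∀ k, EmbedsOn H G (S.filter (fun w => rank w < k)) := by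
    intro k
    induction k with
    | zero => exact ⟨fun _ => Classical.arbitrary V, by simp, by simp⟩
    | succ k ih =>
      by_cases hk : ∃ v ∈ S, rank v = k
      · obtain ⟨v, hv, rfl⟩ := hk
        have heq : S.filter (fun w => rank w < rank v + 1) =
            Insert.insert v (S.filter (fun w => rank w < rank v)) := by
          ext w
          simp only [Finset.mem_filter, Finset.mem_insert]
          constructor
          · rintro ⟨hw, hlt⟩
            rcases (Nat.lt_succ_iff.1 hlt).eq_or_lt with h | h
            · exact Or.inl (hrank hw hv h)
            · exact Or.inr ⟨hw, h⟩
          · rintro (rfl | ⟨hw, hlt⟩)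
            · exact ⟨hv, Nat.lt_succ_self _⟩
            · exact ⟨hw, hlt.trans (Nat.lt_succ_self _)⟩
        have hss : S.filter (fun w => rank w < rank v) ⊂ S :=
          Finset.filter_ssubset.2 ⟨v, hv, lt_irrefl _⟩
        have hlt := Finset.card_lt_card hss
        rw [heq]
        refine ih.insert hG hℓ (by omega) (by omega) (by omega) (by simp) ?_
        intro x hx y hy
        rw [Finset.mem_filter] at hx hy
        exact huniq v hv x hx.1 y hy.1 hx.2 hy.2
      · have heq : S.filter (fun w => rank w < k + 1) = S.filter (fun w => rank w < k) := by
          refine Finset.filter_congr fun w hw => ?_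
          have : rank w ≠ k := fun h => hk ⟨w, hw, h⟩
          omega
        rwa [heq]
  obtain ⟨k, hk⟩ : ∃ k, ∀ w ∈ S, rank w < k :=
    ⟨S.sup rank + 1, fun w hw => Nat.lt_succ_of_le (Finset.le_sup hw)⟩
  have h := key k
  rwa [Finset.filter_true_of_mem hk] at h

theorem EmbedsOn.biUnion_path {S : Finset W} (hS : EmbedsOn H G S) {γ m : ℕ}
    (hG : ∀ (U : Finset V) (x y : V), U.card ≤ m → x ≠ y → ¬ G.Adj x y → x ∉ U → y ∉ U →
      HasInducedPath G U (γ + 1) x y)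
    {I : Type*} [DecidableEq I] (q : I → Fin γ → W)
    (hq : ∀ i j k l, q i k = q j l → i = j ∧ k = l) (hqS : ∀ i k, q i k ∉ S)
    (x y : I → W) (hx : ∀ i, x i ∈ S) (hy : ∀ i, y i ∈ S) (hxy : ∀ i, x i ≠ y i)
    (hnadj : ∀ i, ¬ H.Adj (x i) (y i))
    (hqq : ∀ i j k l, H.Adj (q i k) (q j l) ↔
      i = j ∧ ((l : ℕ) = k + 1 ∨ (k : ℕ) = l + 1))
    (hqw : ∀ i k, ∀ w ∈ S,
      (H.Adj (q i k) w ↔ (k : ℕ) = 0 ∧ w = x i ∨ (k : ℕ) + 1 = γ ∧ w = y i))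
    (J : Finset I) (hJ : (S ∪ J.biUnion fun i => Finset.univ.image (q i)).card ≤ m) :
    EmbedsOn H G (S ∪ J.biUnion fun i => Finset.univ.image (q i)) := by
  induction J using Finset.induction_on with
  | empty => simpa using hS
  | insert i J hi ih =>
    have heq : S ∪ (Insert.insert i J).biUnion (fun i => Finset.univ.image (q i)) =
        (S ∪ J.biUnion fun i => Finset.univ.image (q i)) ∪ Finset.univ.image (q i) := by
      rw [Finset.biUnion_insert, Finset.union_comm (Finset.univ.image (q i)), Finset.union_assoc]
    rw [heq] at hJ ⊢
    have hc := (Finset.card_le_card (Finset.subset_union_left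
      (s₁ := S ∪ J.biUnion fun i => Finset.univ.image (q i))
      (s₂ := Finset.univ.image (q i)))).trans hJ
    have hmem : ∀ w, w ∈ (S ∪ J.biUnion fun i => Finset.univ.image (q i)) ↔
        w ∈ S ∨ ∃ j ∈ J, ∃ k, q j k = w := by simp
    refine (ih hc).union_path hG hc (fun k l h => (hq i i k l h).2) ?_
      (Finset.mem_union_left _ (hx i)) (Finset.mem_union_left _ (hy i)) (hxy i) (hnadj i) ?_ ?_
    · intro k hk
      rw [hmem] at hk
      rcases hk with hk | ⟨j, hj, l, hl⟩
      · exact hqS i k hk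
      · exact hi ((hq _ _ _ _ hl).1 ▸ hj)
    · intro k l
      simp [hqq]
    · intro k w hw
      rw [hmem] at hw
      rcases hw with hw | ⟨j, hj, l, rfl⟩
      · exact hqw i k w hw
      · have h1 : i ≠ j := fun h => hi (h ▸ hj)
        have h2 : q j l ≠ x i := fun h => hqS j l (h ▸ hx i)
        have h3 : q j l ≠ y i := fun h => hqS j l (h ▸ hy i)
        simp [hqq, h1, h2, h3]

end Embedding

theorem EmbedsOn.exists_isInducedCopy {V W : Type} [Fintype W] {H : SimpleGraph W}
    {G : SimpleGraph V} (h : EmbedsOn H G Finset.univ) : ∃ s : Set V, IsInducedCopy H G s := by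
  obtain ⟨f, hf, hadj⟩ := h
  rw [Finset.coe_univ, Set.injOn_univ] at hf
  refine ⟨Set.range f, ⟨⟨Equiv.ofInjective f hf, ?_⟩⟩⟩
  intro x y
  simpa using hadj x (Finset.mem_univ _) y (Finset.mem_univ _)

/-! ### Embedding the graphs `W_a^{γ,*}` -/

theorem ωr_zero (r : ℕ) : ωr r 0 = 0 := by simp [ωr]

theorem ωr_eq_sum {r : ℕ} (hr : 2 ≤ r) (a : ℕ) : ωr r a = ∑ i ∈ Finset.range a, r ^ i :=
  (Nat.geomSum_eq hr a).symm

theorem ωr_succ {r : ℕ} (hr : 2 ≤ r) (a : ℕ) : ωr r (a + 1) = r * ωr r a + 1 := by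
  rw [ωr_eq_sum hr, ωr_eq_sum hr, Finset.sum_range_succ', Finset.mul_sum]
  simp [pow_succ, mul_comm]

theorem heapDepth_lt {r : ℕ} (hr : 2 ≤ r) {a i : ℕ} (hi : i < ωr r a) : heapDepth r i < a := by
  induction a generalizing i with
  | zero => simp [ωr_zero] at hi
  | succ a ih =>
    cases i with
    | zero => simp [heapDepth]
    | succ j =>
      rw [ωr_succ hr] at hi
      rw [heapDepth]
      have := ih (i := j / r) (by rw [Nat.div_lt_iff_lt_mul (by omega), mul_comm]; omega)
      omega

/-- The vertices of the two paths and the two trees from which `W_a^{γ,*}` is built. -/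
def IsHead {γ r a : ℕ} : WSVert γ r a → Prop
  | .inl _ => True
  | .inr (.inl iv) => (iv.2 : ℕ) = 0
  | .inr (.inr (.inl _)) => False
  | .inr (.inr (.inr (.inl _))) => True
  | .inr (.inr (.inr (.inr iv))) => (iv.2 : ℕ) = 0

/-- An enumeration of the vertices of the two paths and the two trees, piece by piece. -/
def headRank {γ r a : ℕ} : WSVert γ r a → ℕ
  | .inl u => u
  | .inr (.inl iv) => a + iv.1
  | .inr (.inr (.inl _)) => 0
  | .inr (.inr (.inr (.inl d))) => a + ωr r a + d
  | .inr (.inr (.inr (.inr iv))) => a + ωr r a + ωr r a + iv.1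

/-- The rank of the parent of a vertex in the forest formed by the two paths and two trees. -/
def parentRank {γ r a : ℕ} : WSVert γ r a → ℕ
  | .inl u => u - 1
  | .inr (.inl iv) => a + (iv.1 - 1) / r
  | .inr (.inr (.inl _)) => 0
  | .inr (.inr (.inr (.inl d))) => a + ωr r a + d - 1
  | .inr (.inr (.inr (.inr iv))) => a + ωr r a + ωr r a + (iv.1 - 1) / r

theorem headRank_injOn {γ r a : ℕ} : Set.InjOn headRank {v : WSVert γ r a | IsHead v} := by
  rintro (u | ⟨i, k⟩ | ⟨i, k⟩ | d | ⟨i, k⟩) hv (u' | ⟨i', k'⟩ | ⟨i', k'⟩ | d' | ⟨i', k'⟩) hv' h <;>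
    simp only [IsHead, headRank, Set.mem_ofPred_eq] at hv hv' h
  all_goals
    first
    | (exfalso; omega)
    | (simp only [Sum.inl.injEq, Sum.inr.injEq, Prod.mk.injEq, Fin.ext_iff]; omega)

theorem headRank_eq_parentRank {γ r a : ℕ} (hγ : 1 ≤ γ) {v x : WSVert γ r a}
    (hv : IsHead v) (hx : IsHead x) (hlt : headRank x < headRank v) (hadj : (WSG γ r a).Adj v x) :
    headRank x = parentRank v := by
  have hdiv : ∀ i j : ℕ, 1 ≤ i → j = (i - 1) / r → j < i := fun i j hi hj => by
    have := Nat.div_le_self (i - 1) r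
    omega
  rw [WSG, SimpleGraph.fromRel_adj] at hadj
  obtain ⟨-, hadj⟩ := hadj
  rcases v with u | ⟨i, k⟩ | ⟨i, k⟩ | d | ⟨i, k⟩ <;>
    rcases x with u' | ⟨i', k'⟩ | ⟨i', k'⟩ | d' | ⟨i', k'⟩ <;>
    simp only [IsHead, headRank, parentRank, WSbase, Fin.ext_iff, or_false, false_or] at hv hx hlt hadj ⊢
  all_goals first | (exfalso; omega) | omega | skip
  all_goals
    rcases hadj with hadj | hadj
    · omega
    · rcases hadj with hadj | hadj
      · omega
      · have := hdiv _ _ hadj.2.2.1 hadj.2.2.2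
        omega

/-- The inner vertices of the paths of `W_a^{γ,*}` that join the trees to the paths and the first
tree to the second path. -/
def linkVertex {γ r a : ℕ} :
    Fin (ωr r a) ⊕ (Fin (ωr r a) ⊕ Fin (ωr r (ωr r a))) → Fin γ → WSVert γ r a
  | .inl i, k => .inr (.inl (i, k.succ))
  | .inr (.inl i), k => .inr (.inr (.inl (i, k)))
  | .inr (.inr i), k => .inr (.inr (.inr (.inr (i, k.succ))))

/-- The tree vertex at which a joining path of `W_a^{γ,*}` starts. -/
def linkSource {γ r a : ℕ} :
    Fin (ωr r a) ⊕ (Fin (ωr r a) ⊕ Fin (ωr r (ωr r a))) → WSVert γ r a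
  | .inl i => .inr (.inl (i, 0))
  | .inr (.inl i) => .inr (.inl (i, 0))
  | .inr (.inr i) => .inr (.inr (.inr (.inr (i, 0))))

/-- The path vertex at which a joining path of `W_a^{γ,*}` ends. -/
def linkTarget {γ r a : ℕ} (hr : 2 ≤ r) :
    Fin (ωr r a) ⊕ (Fin (ωr r a) ⊕ Fin (ωr r (ωr r a))) → WSVert γ r a
  | .inl i => .inl ⟨heapDepth r i, heapDepth_lt hr i.2⟩
  | .inr (.inl i) => .inr (.inr (.inr (.inl i)))
  | .inr (.inr i) => .inr (.inr (.inr (.inl ⟨heapDepth r i, heapDepth_lt hr i.2⟩)))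

section Link

variable {γ r a : ℕ}

theorem linkVertex_inj (i j : Fin (ωr r a) ⊕ (Fin (ωr r a) ⊕ Fin (ωr r (ωr r a)))) (k l : Fin γ)
    (h : linkVertex i k = linkVertex j l) : i = j ∧ k = l := by
  rcases i with i | i | i <;> rcases j with j | j | j <;> simp [linkVertex] at h ⊢ <;> exact h

theorem not_isHead_linkVertex (i : Fin (ωr r a) ⊕ (Fin (ωr r a) ⊕ Fin (ωr r (ωr r a))))
    (k : Fin γ) : ¬ IsHead (linkVertex i k) := by
  rcases i with i | i | i <;> simp [linkVertex, IsHead]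

theorem exists_linkVertex {v : WSVert γ r a} (hv : ¬ IsHead v) : ∃ i k, linkVertex i k = v := by
  rcases v with u | ⟨i, k⟩ | ⟨i, k⟩ | d | ⟨i, k⟩ <;> simp only [IsHead, not_true] at hv
  · obtain ⟨l, rfl⟩ := Fin.exists_succ_eq.2 (fun h : k = 0 => hv (by simp [h]))
    exact ⟨.inl i, l, rfl⟩
  · exact ⟨.inr (.inl i), k, rfl⟩
  · obtain ⟨l, rfl⟩ := Fin.exists_succ_eq.2 (fun h : k = 0 => hv (by simp [h]))
    exact ⟨.inr (.inr i), l, rfl⟩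

theorem WSG_adj_linkVertex (i j : Fin (ωr r a) ⊕ (Fin (ωr r a) ⊕ Fin (ωr r (ωr r a))))
    (k l : Fin γ) : (WSG γ r a).Adj (linkVertex i k) (linkVertex j l) ↔
      i = j ∧ ((l : ℕ) = k + 1 ∨ (k : ℕ) = l + 1) := by
  rw [WSG, SimpleGraph.fromRel_adj]
  rcases i with i | i | i <;> rcases j with j | j | j <;>
    simp [linkVertex, WSbase, Fin.ext_iff] <;> omega

theorem WSG_adj_linkVertex_head (hr : 2 ≤ r)
    (i : Fin (ωr r a) ⊕ (Fin (ωr r a) ⊕ Fin (ωr r (ωr r a))))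
    (k : Fin γ) {w : WSVert γ r a} (hw : IsHead w) :
    (WSG γ r a).Adj (linkVertex i k) w ↔
      (k : ℕ) = 0 ∧ w = linkSource i ∨ (k : ℕ) + 1 = γ ∧ w = linkTarget hr i := by
  have hk := k.2
  rw [WSG, SimpleGraph.fromRel_adj]
  rcases i with i | i | i <;> rcases w with u | ⟨j, l⟩ | ⟨j, l⟩ | d | ⟨j, l⟩ <;>
    simp only [linkVertex, linkSource, linkTarget, IsHead, WSbase, Sum.inl.injEq, Sum.inr.injEq,
      Prod.mk.injEq, reduceCtorEq, ne_eq, Fin.ext_iff, Fin.val_succ, Fin.val_zero, not_false_eq_true,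
      true_and, and_false, false_and, or_false, false_or] at hw ⊢ <;> omega

theorem not_WSG_adj_link (hγ : 1 ≤ γ) (hr : 2 ≤ r)
    (i : Fin (ωr r a) ⊕ (Fin (ωr r a) ⊕ Fin (ωr r (ωr r a)))) :
    ¬ (WSG γ r a).Adj (linkSource i) (linkTarget hr i) := by
  rw [WSG, SimpleGraph.fromRel_adj]
  rcases i with i | i | i <;> simp [linkSource, linkTarget, WSbase] <;> omega

end Link

theorem card_WSVert (γ r a : ℕ) : Fintype.card (WSVert γ r a) = Vnum γ r a := by
  simp [Vnum]
  ring

open scoped Classical in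
theorem exists_isInducedCopy_WSG {γ r a M ℓ m : ℕ} (hγ : 1 ≤ γ) (hr : 2 ≤ r)
    {V : Type} [Fintype V] [Nonempty V] {G : SimpleGraph V} (hG : IsExpanding G M ℓ) (hℓ : 1 ≤ ℓ)
    (hP : ∀ (U : Finset V) (x y : V), U.card ≤ m → x ≠ y → ¬ G.Adj x y → x ∉ U → y ∉ U →
      HasInducedPath G U (γ + 1) x y)
    (haℓ : Vnum γ r a ≤ ℓ) (haM : Vnum γ r a ≤ M) (haV : Vnum γ r a ≤ Fintype.card V)
    (ham : Vnum γ r a ≤ m) : ∃ s : Set V, IsInducedCopy (WSG γ r a) G s := by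
  have hcard : ∀ S : Finset (WSVert γ r a), S.card ≤ Vnum γ r a := fun S =>
    (Finset.card_le_univ S).trans_eq (card_WSVert γ r a)
  let S : Finset (WSVert γ r a) := Finset.univ.filter IsHead
  have hS : ∀ v, v ∈ S ↔ IsHead v := by simp [S]
  have hinj : Set.InjOn headRank (S : Set (WSVert γ r a)) := fun x hx y hy =>
    headRank_injOn ((hS x).1 hx) ((hS y).1 hy)
  have h1 : EmbedsOn (WSG γ r a) G S := by
    refine EmbedsOn.of_rank hG hℓ ((hcard S).trans haℓ) ((hcard S).trans haM)
      ((hcard S).trans haV) headRank hinj ?_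
    intro v hv x hx y hy hxv hyv hvx hvy
    refine hinj hx hy ?_
    rw [headRank_eq_parentRank hγ ((hS v).1 hv) ((hS x).1 hx) hxv hvx,
      headRank_eq_parentRank hγ ((hS v).1 hv) ((hS y).1 hy) hyv hvy]
  have h2 := h1.biUnion_path hP linkVertex linkVertex_inj
    (fun i k h => not_isHead_linkVertex i k ((hS _).1 h)) linkSource (linkTarget hr)
    (fun i => (hS _).2 (by rcases i with i | i | i <;> simp [linkSource, IsHead]))
    (fun i => (hS _).2 (by rcases i with i | i | i <;> simp [linkTarget, IsHead]))
    (fun i => by rcases i with i | i | i <;> simp [linkSource, linkTarget])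
    (not_WSG_adj_link hγ hr) WSG_adj_linkVertex
    (fun i k w hw => WSG_adj_linkVertex_head hr i k ((hS w).1 hw)) Finset.univ
    ((hcard _).trans ham)
  refine EmbedsOn.exists_isInducedCopy (H := WSG γ r a) ?_
  convert h2
  refine (Finset.eq_univ_iff_forall.2 fun v => ?_).symm
  rw [Finset.mem_union, hS]
  by_cases hv : IsHead v
  · exact Or.inl hv
  · obtain ⟨i, k, rfl⟩ := exists_linkVertex hv
    exact Or.inr (Finset.mem_biUnion.2 ⟨i, Finset.mem_univ _, Finset.mem_image_of_mem _
      (Finset.mem_univ _)⟩)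

/-! ### Asymptotics -/

theorem one_sub_le_prob_exists_isInducedCopy {n r t c k D : ℕ} {p : ℝ} (hp0 : 0 ≤ p) (hp1 : p ≤ 1)
    (hr : 2 ≤ r) (ht : 1 ≤ t) (hn : 2 ≤ n) (hD : 2 ≤ D)
    (hℓ : ((k + (2 * t + c) + 4 * D ^ (t - 1) : ℕ) : ℝ) * p ≤ 1 / 2)
    (hM : (1 + 2 * ((k + (2 * t + c) + 8 * D : ℕ) : ℝ)) * Real.log (n + 1) ≤ p * n / 16)
    (hs : 2 * Real.log (n + 1) ≤ p * (D ^ t : ℕ) / 2) :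
    1 - 2 / ((n : ℝ) + 1) ≤ prob n p (fun G => ∀ a : ℕ, 1 ≤ a → Vnum (2 * t + c) r a ≤ k →
      ∃ s : Set (Fin n), IsInducedCopy (WSG (2 * t + c) r a) G s) := by
  set m := k + (2 * t + c) with hm
  set ℓ := m + 4 * D ^ (t - 1) with hℓdef
  set M := m + 8 * D with hMdef
  have hn' : (2 : ℝ) ≤ n := by exact_mod_cast hn
  have hn1 : (0 : ℝ) < (n : ℝ) + 1 := by linarith
  have hlog : 1 ≤ Real.log ((n : ℝ) + 1) := by
    rw [Real.le_log_iff_exp_le hn1]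
    linarith [Real.exp_one_lt_three]
  have hM1 : (1 : ℝ) ≤ M := by exact_mod_cast (show 1 ≤ M by omega)
  have hDt : 1 ≤ D ^ (t - 1) := Nat.one_le_pow _ _ (by omega)
  have hℓ0 : (0 : ℝ) ≤ ℓ := Nat.cast_nonneg _
  have hMℓ : 2 * ((1 + 2 * M) * ℓ) ≤ n := by
    have h1 : 1 + 2 * (M : ℝ) ≤ p * n / 16 := by nlinarith
    have h2 : (1 + 2 * (M : ℝ)) * ℓ ≤ p * n / 16 * ℓ := mul_le_mul_of_nonneg_right h1 hℓ0
    have h3 : (n : ℝ) * (ℓ * p) ≤ n * (1 / 2) := mul_le_mul_of_nonneg_left hℓ (by linarith)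
    have h4 : 2 * ((1 + 2 * (M : ℝ)) * ℓ) ≤ n := by linarith
    exact_mod_cast h4
  have hkn : k ≤ n := by nlinarith
  have : Nonempty (Fin n) := ⟨⟨0, by omega⟩⟩
  have hgood : ∀ G : SimpleGraph (Fin n), ¬ (¬ IsExpanding G M ℓ ∨ ¬ IsJoining G (D ^ t)) →
      ∀ a : ℕ, 1 ≤ a → Vnum (2 * t + c) r a ≤ k →
        ∃ s : Set (Fin n), IsInducedCopy (WSG (2 * t + c) r a) G s := by
    intro G hG a _ ha
    push Not at hG
    refine exists_isInducedCopy_WSG (m := k) (by omega) hr hG.1 (by omega) ?_ (by omega) (by omega)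
      (by rw [Fintype.card_fin]; omega) ha
    intro U x y hU hxy hadj hx hy
    have := hG.1.hasInducedPath hD hG.2 c (U := U) (by omega) hxy hadj hx hy
    rwa [show 2 * t + c + 1 = 2 * t + 1 + c by ring]
  have hE := prob_not_isExpanding_le (n := n) hp0 hp1 hℓ hMℓ hM
  have hJ := prob_not_isJoining_le (n := n) hp0 hp1 (Nat.one_le_pow t D (by omega)) hs
  have hexp : Real.exp (-(2 * Real.log ((n : ℝ) + 1))) = 1 / ((n : ℝ) + 1) ^ 2 := by
    rw [Real.exp_neg, mul_comm, Real.exp_mul, Real.exp_log hn1, one_div]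
    norm_cast
  have hE' : (n : ℝ) * Real.exp (-(p * n / 16)) ≤ 1 / ((n : ℝ) + 1) := by
    have h1 : Real.exp (-(p * n / 16)) ≤ 1 / ((n : ℝ) + 1) ^ 2 := by
      rw [← hexp, Real.exp_le_exp]
      nlinarith
    calc (n : ℝ) * Real.exp (-(p * n / 16)) ≤ ((n : ℝ) + 1) * (1 / ((n : ℝ) + 1) ^ 2) := by
          gcongr
          linarith
      _ = _ := by field_simp
  have hJ' : Real.exp (-(p * (D ^ t : ℕ) / 2)) ≤ 1 / ((n : ℝ) + 1) := by
    calc _ ≤ 1 / ((n : ℝ) + 1) ^ 2 := by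
          rw [← hexp, Real.exp_le_exp]
          linarith
      _ ≤ 1 / ((n : ℝ) + 1) := by
          gcongr
          nlinarith
  have h := prob_mono hp0 hp1 hgood
  have hnot := prob_not (p := p)
    (fun G : SimpleGraph (Fin n) => ¬ IsExpanding G M ℓ ∨ ¬ IsJoining G (D ^ t))
  have hor := prob_or_le hp0 hp1 (fun G => ¬ IsExpanding G M ℓ)
    (fun G : SimpleGraph (Fin n) => ¬ IsJoining G (D ^ t))
  have : (2 : ℝ) / (n + 1) = 1 / (n + 1) + 1 / (n + 1) := by ring
  linarith

theorem tendsto_natCast_rpow_of_neg {e : ℝ} (he : e < 0) :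
    Tendsto (fun n : ℕ => (n : ℝ) ^ e) atTop (nhds 0) := by
  have := (tendsto_rpow_neg_atTop (neg_pos.2 he)).comp tendsto_natCast_atTop_atTop
  simpa [Function.comp_def] using this

theorem eventually_log_add_one_le_rpow {ε : ℝ} (hε : 0 < ε) :
    ∀ᶠ n : ℕ in atTop, Real.log ((n : ℝ) + 1) ≤ (n : ℝ) ^ ε := by
  have h := ((isLittleO_log_rpow_atTop hε).bound (show (0 : ℝ) < 1 / 2 by norm_num))
  filter_upwards [tendsto_natCast_atTop_atTop.eventually h, eventually_ge_atTop 2] with n hn hn2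
  have hn2' : (2 : ℝ) ≤ n := by exact_mod_cast hn2
  rw [Real.norm_of_nonneg (Real.log_nonneg (by linarith)),
    Real.norm_of_nonneg (by positivity)] at hn
  calc Real.log ((n : ℝ) + 1) ≤ Real.log ((n : ℝ) ^ 2) :=
        Real.log_le_log (by linarith) (by nlinarith)
    _ = 2 * Real.log n := by rw [Real.log_pow]; norm_num
    _ ≤ _ := by linarith

section Parameters

variable {α β δ : ℝ} {t : ℕ}

theorem eventually_expansion_size_le (hα : 0 < α) (hβ : β < α) (hδ : δ * (t - 1 : ℕ) < α) (γ : ℕ) :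
    ∀ᶠ n : ℕ in atTop, ((⌊(n : ℝ) ^ β⌋₊ + γ + 4 * ⌊(n : ℝ) ^ δ⌋₊ ^ (t - 1) : ℕ) : ℝ) *
      (n : ℝ) ^ (-α) ≤ 1 / 2 := by
  have hlim : Tendsto (fun n : ℕ => (n : ℝ) ^ (β - α) + γ * (n : ℝ) ^ (-α) +
      4 * (n : ℝ) ^ (δ * (t - 1 : ℕ) - α)) atTop (nhds (0 + γ * 0 + 4 * 0)) :=
    ((tendsto_natCast_rpow_of_neg (by linarith)).add
      ((tendsto_natCast_rpow_of_neg (by linarith)).const_mul _)).add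
      ((tendsto_natCast_rpow_of_neg (by linarith)).const_mul _)
  filter_upwards [hlim.eventually_le_const (u := 1 / 2) (by norm_num), eventually_ge_atTop 1]
    with n hn hn1
  have hn0 : (0 : ℝ) < n := by exact_mod_cast hn1
  refine le_trans ?_ hn
  rw [sub_eq_add_neg, sub_eq_add_neg, Real.rpow_add hn0, Real.rpow_add hn0, Real.rpow_mul hn0.le,
    Real.rpow_natCast, ← mul_assoc, ← add_mul, ← add_mul]
  push_cast
  gcongr <;> exact Nat.floor_le (by positivity)

theorem eventually_neighbour_size_le (hα : α < 1) (hβ : β < 1 - α) (hδ : δ < 1 - α) (γ : ℕ) :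
    ∀ᶠ n : ℕ in atTop, (1 + 2 * ((⌊(n : ℝ) ^ β⌋₊ + γ + 8 * ⌊(n : ℝ) ^ δ⌋₊ : ℕ) : ℝ)) *
      Real.log (n + 1) ≤ (n : ℝ) ^ (-α) * n / 16 := by
  have hα' : 0 < 1 - α := by linarith
  obtain ⟨ε, hε0, hε⟩ := exists_between (a₁ := 0) (a₂ := min (1 - α) (min (1 - α - β) (1 - α - δ)))
    (lt_min hα' (lt_min (by linarith) (by linarith)))
  obtain ⟨hε1, hε2, hε3⟩ : ε < 1 - α ∧ ε < 1 - α - β ∧ ε < 1 - α - δ := by simpa using hε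
  have hlim : Tendsto (fun n : ℕ => (1 + 2 * γ) * (n : ℝ) ^ (ε + -(1 - α)) +
      2 * (n : ℝ) ^ (β + (ε + -(1 - α))) + 16 * (n : ℝ) ^ (δ + (ε + -(1 - α)))) atTop
      (nhds ((1 + 2 * γ) * 0 + 2 * 0 + 16 * 0)) :=
    (((tendsto_natCast_rpow_of_neg (by linarith)).const_mul _).add
      ((tendsto_natCast_rpow_of_neg (by linarith)).const_mul _)).add
      ((tendsto_natCast_rpow_of_neg (by linarith)).const_mul _)
  filter_upwards [hlim.eventually_le_const (u := 1 / 16) (by norm_num), eventually_ge_atTop 1,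
    eventually_log_add_one_le_rpow hε0] with n hn hn1 hlog
  have hn0 : (0 : ℝ) < n := by exact_mod_cast hn1
  have hpn : (n : ℝ) ^ (-α) * n = (n : ℝ) ^ (1 - α) := by
    rw [sub_eq_neg_add, Real.rpow_add hn0, Real.rpow_one]
  have hβn : (⌊(n : ℝ) ^ β⌋₊ : ℝ) ≤ (n : ℝ) ^ β := Nat.floor_le (by positivity)
  have hδn : (⌊(n : ℝ) ^ δ⌋₊ : ℝ) ≤ (n : ℝ) ^ δ := Nat.floor_le (by positivity)
  calc _ ≤ (1 + 2 * ((n : ℝ) ^ β + γ + 8 * (n : ℝ) ^ δ)) * (n : ℝ) ^ ε := by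
        have := Real.log_nonneg (show (1 : ℝ) ≤ (n : ℝ) + 1 by linarith)
        push_cast
        gcongr
    _ = ((1 + 2 * γ) * (n : ℝ) ^ (ε + -(1 - α)) + 2 * (n : ℝ) ^ (β + (ε + -(1 - α))) +
        16 * (n : ℝ) ^ (δ + (ε + -(1 - α)))) * (n : ℝ) ^ (1 - α) := by
      have : (n : ℝ) ^ ε = (n : ℝ) ^ (ε + -(1 - α)) * (n : ℝ) ^ (1 - α) := by
        rw [← Real.rpow_add hn0]
        ring_nf
      rw [this, Real.rpow_add hn0 β, Real.rpow_add hn0 δ]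
      ring
    _ ≤ 1 / 16 * (n : ℝ) ^ (1 - α) := by gcongr
    _ = _ := by rw [hpn]; ring

theorem eventually_le_joining_size (hδ0 : 0 < δ) (hδ : α < δ * t) :
    ∀ᶠ n : ℕ in atTop,
      2 * Real.log (n + 1) ≤ (n : ℝ) ^ (-α) * (⌊(n : ℝ) ^ δ⌋₊ ^ t : ℕ) / 2 := by
  obtain ⟨ε, hε0, hε⟩ := exists_between (a₁ := 0) (a₂ := δ * t - α) (by linarith)
  have hlim : Tendsto (fun n : ℕ => 4 * (n : ℝ) ^ (ε + α - δ * t)) atTop (nhds (4 * 0)) :=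
    (tendsto_natCast_rpow_of_neg (by linarith)).const_mul _
  have hδn : Tendsto (fun n : ℕ => (n : ℝ) ^ δ) atTop atTop :=
    (tendsto_rpow_atTop hδ0).comp tendsto_natCast_atTop_atTop
  filter_upwards [hlim.eventually_le_const (u := (1 / 2) ^ t) (by simp), eventually_ge_atTop 1,
    eventually_log_add_one_le_rpow hε0, hδn.eventually_ge_atTop 2] with n hn hn1 hlog hD
  have hn0 : (0 : ℝ) < n := by exact_mod_cast hn1
  have hfl : (n : ℝ) ^ δ * (1 / 2) ≤ ⌊(n : ℝ) ^ δ⌋₊ := by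
    linarith [Nat.lt_floor_add_one ((n : ℝ) ^ δ)]
  calc 2 * Real.log ((n : ℝ) + 1) ≤ 2 * (n : ℝ) ^ ε := by gcongr
    _ = (n : ℝ) ^ (-α) * ((n : ℝ) ^ (δ * t) * (4 * (n : ℝ) ^ (ε + α - δ * t))) / 2 := by
      have : (n : ℝ) ^ ε = (n : ℝ) ^ (-α) * ((n : ℝ) ^ (δ * t) * (n : ℝ) ^ (ε + α - δ * t)) := by
        rw [← Real.rpow_add hn0, ← Real.rpow_add hn0]
        ring_nf
      rw [this]
      ring
    _ ≤ (n : ℝ) ^ (-α) * ((n : ℝ) ^ (δ * t) * (1 / 2) ^ t) / 2 := by gcongr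
    _ = (n : ℝ) ^ (-α) * ((n : ℝ) ^ δ * (1 / 2)) ^ t / 2 := by
      rw [Real.rpow_mul hn0.le, Real.rpow_natCast, mul_pow]
    _ ≤ _ := by
      push_cast
      gcongr

end Parameters

/-- Lemma 2.2(a): Let α ∈ (0,1), r ≥ 2, and 0 < β < min{α, (2/3)(1−α)}.
Then for every sufficiently large integer γ, a.a.s., for every a ≥ 1 with
V_{γ,r}(a) ≤ n^β, the graph G(n, n^{−α}) contains an induced copy of W_a^{γ,*}. -/
theorem stmt6 (α : ℝ) (hα0 : 0 < α) (hα1 : α < 1) (r : ℕ) (hr : 2 ≤ r)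
    (β : ℝ) (hβ0 : 0 < β) (hβ : β < min α (2 / 3 * (1 - α))) :
    ∃ γ₀ : ℕ, ∀ γ : ℕ, γ₀ ≤ γ →
      Tendsto (fun n : ℕ =>
          prob n ((n : ℝ) ^ (-α)) (fun G =>
            ∀ a : ℕ, 1 ≤ a → (Vnum γ r a : ℝ) ≤ (n : ℝ) ^ β →
              ∃ s : Set (Fin n), IsInducedCopy (WSG γ r a) G s))
        atTop (nhds 1) := by
  obtain ⟨hβα, hβ1⟩ := lt_min_iff.1 hβ
  have hα' : 0 < 1 - α := by linarith
  obtain ⟨t, ht⟩ := exists_nat_gt (α / (1 - α) + 1)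
  have ht1 : (1 : ℝ) < t := lt_trans (by linarith [div_pos hα0 hα']) ht
  have ht1' : 1 ≤ t := by exact_mod_cast ht1.le
  have hpos : (0 : ℝ) < t - 1 / 2 := by linarith
  obtain ⟨δ, hδ⟩ : ∃ δ, δ = α / (t - 1 / 2) := ⟨_, rfl⟩
  have hδ0 : 0 < δ := hδ ▸ div_pos hα0 hpos
  have hδt : δ * (t - 1 / 2) = α := by rw [hδ, div_mul_cancel₀ _ hpos.ne']
  have hδ1 : δ < 1 - α := by
    rw [hδ, div_lt_iff₀ hpos, ← div_lt_iff₀' hα']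
    linarith
  refine ⟨2 * t, fun γ hγ => ?_⟩
  obtain ⟨c, rfl⟩ := Nat.exists_eq_add_of_le hγ
  have hlim : Tendsto (fun n : ℕ => 1 - 2 / ((n : ℝ) + 1)) atTop (nhds 1) := by
    simpa using (tendsto_const_nhds (x := (1 : ℝ))).sub
      (tendsto_const_nhds.div_atTop (tendsto_natCast_atTop_atTop.atTop_add tendsto_const_nhds))
  have hδn : Tendsto (fun n : ℕ => (n : ℝ) ^ δ) atTop atTop :=
    (tendsto_rpow_atTop hδ0).comp tendsto_natCast_atTop_atTop
  have hp : ∀ n : ℕ, 1 ≤ n → 0 ≤ (n : ℝ) ^ (-α) ∧ (n : ℝ) ^ (-α) ≤ 1 := fun n hn =>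
    ⟨by positivity, Real.rpow_le_one_of_one_le_of_nonpos (by exact_mod_cast hn) (by linarith)⟩
  refine tendsto_of_tendsto_of_tendsto_of_le_of_le' hlim tendsto_const_nhds ?_ ?_
  · filter_upwards [eventually_ge_atTop 2, hδn.eventually_ge_atTop 2,
      eventually_expansion_size_le (β := β) (δ := δ) (t := t) hα0 hβα
        (by rw [Nat.cast_sub ht1']; push_cast; nlinarith) (2 * t + c),
      eventually_neighbour_size_le (β := β) (δ := δ) hα1 (by linarith) hδ1 (2 * t + c),
      eventually_le_joining_size (α := α) (t := t) hδ0 (by nlinarith)] with n hn hD hℓ hM hs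
    obtain ⟨hp0, hp1⟩ := hp n (by omega)
    refine (one_sub_le_prob_exists_isInducedCopy hp0 hp1 hr ht1' hn (Nat.le_floor hD) hℓ hM
      hs).trans (prob_mono hp0 hp1 fun G hG a ha hV => hG a ha (Nat.le_floor hV))
  · filter_upwards [eventually_ge_atTop 1] with n hn
    exact prob_le_one (hp n hn).1 (hp n hn).2 _
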